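/- Let 0 < β < α < 1 and let φ : [2,∞) → (0,∞) be nondecreasing with lim_{t→∞} φ(t) = ∞ and with φ(2t) ≤ φ(t) + C₀ for all t ≥ 2 and some constant C₀. Then there exist a compact set E ⊂ ℝ, a Borel probability measure μ on ℝ with μ(E) = 1, a sequence of sets F_l ⊂ ℝ (l ≥ 1), each a finite union of intervals with μ(F_l) > 0, and constants 0 < c ≤ C < ∞ such that: (i) |μ̂(ξ)| ≤ C·|ξ|^{−β/2} for all ξ ≠ 0; (ii) for every x ∈ E and r ∈ (0,1/4), c·(2r)^α / φ(1/(2r)) ≤ μ([x−r, x+r]) ≤ C·(2r)^α; and (iii) for every q with 2 ≤ q < 2 + 4(1−α)/β, sup_{l ≥ 1} ‖(1_{F_l} dμ)^∧‖_{L^q(ℝ)} / ‖1_{F_l}‖_{L²(μ)} = ∞. -/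

import Mathlib

open MeasureTheory Filter

namespace ChenSharp

/-- The character `e^{-2πiξx}`. -/
noncomputable def ee (ξ x : ℝ) : ℂ :=
  Complex.exp (-(2 * (Real.pi : ℂ) * Complex.I * (ξ : ℂ) * (x : ℂ)))

lemma ee_eq (ξ x : ℝ) : ee ξ x = Complex.exp (((-(2 * Real.pi * ξ * x) : ℝ) : ℂ) * Complex.I) := by
  unfold ee; congr 1; push_cast; ring

@[simp] lemma norm_ee (ξ x : ℝ) : ‖ee ξ x‖ = 1 := by
  rw [ee_eq, Complex.norm_exp_ofReal_mul_I]

lemma ee_add (ξ x y : ℝ) : ee ξ (x + y) = ee ξ x * ee ξ y := by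
  unfold ee; rw [← Complex.exp_add]; congr 1; push_cast; ring

lemma ee_mul_left (c ξ x : ℝ) : ee ξ (c * x) = ee (c * ξ) x := by
  unfold ee; congr 1; push_cast; ring

@[simp] lemma ee_zero (ξ : ℝ) : ee ξ 0 = 1 := by simp [ee]

lemma continuous_ee (ξ : ℝ) : Continuous (ee ξ) := by unfold ee; fun_prop

lemma continuous_ee2 : Continuous (fun p : ℝ × ℝ => ee p.1 p.2) := by unfold ee; fun_prop

lemma continuous_ee' (x : ℝ) : Continuous (fun ξ => ee ξ x) := by unfold ee; fun_prop

lemma norm_ee_sub_le (ξ η x : ℝ) : ‖ee ξ x - ee η x‖ ≤ 2 * Real.pi * |x| * |ξ - η| := by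
  have h : ee ξ x - ee η x = ee η x * (Complex.exp (Complex.I * ((-(2 * Real.pi * (ξ - η) * x) : ℝ) : ℂ)) - 1) := by
    rw [mul_sub, mul_one, ee_eq, ee_eq, ← Complex.exp_add]; congr 2; push_cast; ring
  rw [h, norm_mul, norm_ee, one_mul]
  refine (Real.norm_exp_I_mul_ofReal_sub_one_le (x := _)).trans ?_
  rw [Real.norm_eq_abs, abs_neg, abs_mul, abs_mul, abs_mul, abs_of_pos Real.pi_pos]
  simp only [Nat.abs_ofNat]; apply le_of_eq; ring

lemma norm_ee_sub_le' (ξ x y : ℝ) : ‖ee ξ x - ee ξ y‖ ≤ 2 * Real.pi * |ξ| * |x - y| := by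
  have h : ∀ a b, ee a b = ee b a := by intro a b; unfold ee; congr 1; ring
  rw [h ξ x, h ξ y]; exact norm_ee_sub_le x y ξ

lemma exp_le_quad {x : ℝ} (hx : |x| ≤ 1) : Real.exp x ≤ 1 + x + x ^ 2 := by
  have := Real.abs_exp_sub_one_sub_id_le hx
  have := (abs_le.1 this).2
  linarith

/-- A continuous function with zero mean on `[0,a]` is nonpositive somewhere. -/
lemma exists_nonpos {a : ℝ} (ha : 0 < a) {Z : ℝ → ℝ} (hZ : Continuous Z)
    (h0 : ∫ u in (0:ℝ)..a, Z u = 0) : ∃ u ∈ Set.Icc 0 a, Z u ≤ 0 := by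
  by_contra hcon
  push Not at hcon
  have : 0 < ∫ u in (0:ℝ)..a, Z u :=
    intervalIntegral.intervalIntegral_pos_of_pos_on (hZ.intervalIntegrable _ _)
      (fun x hx => hcon x ⟨hx.1.le, hx.2.le⟩) ha
  linarith

/-- Greedy (conditional expectation) selection. -/
lemma greedy {κ : Type*} (G : Finset κ) {a : ℝ} (ha : 0 < a) (X : ℕ → κ → ℝ → ℝ)
    (hc : ∀ n g, Continuous (X n g)) (hb : ∀ n g u, |X n g u| ≤ 2)
    (h0 : ∀ n g, ∫ u in (0:ℝ)..a, X n g u = 0) {lam : ℝ} (hl0 : 0 ≤ lam) (hl : lam ≤ 1 / 2)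
    (m : ℕ) : ∃ y : ℕ → ℝ, (∀ n, y n ∈ Set.Icc 0 a) ∧
      ∑ g ∈ G, Real.exp (lam * ∑ n ∈ Finset.range m, X n g (y n))
        ≤ G.card * Real.exp (4 * lam ^ 2 * m) := by
  induction m with
  | zero => exact ⟨fun _ => 0, fun _ => ⟨le_rfl, ha.le⟩, by simp⟩
  | succ m ih =>
    obtain ⟨y, hy, hS⟩ := ih
    set e : κ → ℝ := fun g => Real.exp (lam * ∑ n ∈ Finset.range m, X n g (y n)) with he
    have he0 : ∀ g, 0 ≤ e g := fun g => (Real.exp_pos _).le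
    obtain ⟨u, hu, hZ⟩ := exists_nonpos ha (Z := fun u => ∑ g ∈ G, e g * X m g u)
      (by have := hc m; fun_prop)
      (by
        rw [intervalIntegral.integral_finsetSum]
        · apply Finset.sum_eq_zero; intro g _
          rw [intervalIntegral.integral_const_mul, h0, mul_zero]
        · intro g _; exact (continuous_const.mul (hc m g)).intervalIntegrable _ _)
    refine ⟨Function.update y m u, ?_, ?_⟩
    · intro n; by_cases h : n = m
      · subst h; simpa using hu
      · simpa [h] using hy n
    have h1 : ∀ g, ∑ n ∈ Finset.range (m+1), X n g (Function.update y m u n)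
        = ∑ n ∈ Finset.range m, X n g (y n) + X m g u := by
      intro g
      rw [Finset.sum_range_succ]
      congr 1
      · apply Finset.sum_congr rfl; intro n hn
        rw [Function.update_of_ne (by simp at hn; omega)]
      · simp
    have h2 : ∀ g, Real.exp (lam * ∑ n ∈ Finset.range (m+1), X n g (Function.update y m u n))
        ≤ e g * (1 + 4 * lam^2) + lam * (e g * X m g u) := by
      intro g
      rw [h1, mul_add, Real.exp_add]
      have hbb := hb m g u
      have : |lam * X m g u| ≤ 1 := by
        rw [abs_mul, abs_of_nonneg hl0]; nlinarith [abs_nonneg (X m g u)]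
      have h3 := exp_le_quad this
      have h4 : (X m g u)^2 ≤ 4 := by
        rw [← sq_abs]; nlinarith [abs_nonneg (X m g u)]
      have : Real.exp (lam * X m g u) ≤ 1 + lam * X m g u + 4 * lam^2 := by nlinarith [sq_nonneg lam]
      have := mul_le_mul_of_nonneg_left this (he0 g)
      calc _ ≤ e g * (1 + lam * X m g u + 4 * lam^2) := this
        _ = _ := by ring
    calc _ ≤ ∑ g ∈ G, (e g * (1 + 4 * lam^2) + lam * (e g * X m g u)) := Finset.sum_le_sum fun g _ => h2 g
      _ = (∑ g ∈ G, e g) * (1 + 4 * lam^2) + lam * ∑ g ∈ G, e g * X m g u := by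
        rw [Finset.sum_add_distrib, Finset.sum_mul, Finset.mul_sum]
      _ ≤ (∑ g ∈ G, e g) * (1 + 4 * lam^2) := by
        have := mul_nonpos_of_nonneg_of_nonpos hl0 hZ
        linarith
      _ ≤ (G.card * Real.exp (4 * lam ^ 2 * m)) * Real.exp (4 * lam^2) := by
        gcongr
        have := Real.add_one_le_exp (4 * lam^2); linarith
      _ = _ := by rw [mul_assoc, ← Real.exp_add]; congr 2; push_cast; ring

end ChenSharp

namespace ChenSharp

noncomputable def avg (a : ℝ) (g : ℝ → ℂ) : ℂ := (1 / (a : ℂ)) * ∫ u in (0:ℝ)..a, g u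

lemma norm_avg_le {a : ℝ} (ha : 0 < a) {g : ℝ → ℂ} {C : ℝ}
    (h : ∀ u ∈ Set.Icc 0 a, ‖g u‖ ≤ C) : ‖avg a g‖ ≤ C := by
  unfold avg
  have := intervalIntegral.norm_integral_le_of_norm_le_const (a := 0) (b := a) (f := g) (C := C)
    (fun x hx => h x (by rw [Set.uIoc_of_le ha.le] at hx; exact ⟨hx.1.le, hx.2⟩))
  rw [sub_zero, abs_of_pos ha] at this
  rw [norm_mul, norm_div, norm_one, Complex.norm_real, Real.norm_eq_abs, abs_of_pos ha]
  calc _ ≤ 1 / a * (C * a) := by gcongr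
    _ = C := by field_simp

lemma avg_sub {a : ℝ} {g h : ℝ → ℂ} (hg : Continuous g) (hh : Continuous h) :
    avg a (fun u => g u - h u) = avg a g - avg a h := by
  unfold avg
  rw [intervalIntegral.integral_sub (hg.intervalIntegrable _ _) (hh.intervalIntegrable _ _), mul_sub]

lemma selection {a R : ℝ} (ha : 0 < a) (hR : 0 ≤ R) {m : ℕ} (hm : 1 ≤ m) (p : ℕ → ℝ)
    (hp0 : ∀ n, 0 ≤ p n) (hp1 : ∀ n, p n + R * a ≤ 1) {N : ℕ} (hN : 1 ≤ N) :
    ∃ y : ℕ → ℝ, (∀ n, y n ∈ Set.Icc 0 a) ∧ ∀ ξ : ℝ, |ξ| ≤ N →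
      ‖∑ n ∈ Finset.range m, (ee ξ (p n + R * y n) - avg a (fun u => ee ξ (p n + R * u)))‖
        ≤ 4 * √m * (Real.log (12 * m * N) + 1) + 4 * Real.pi := by
  set Y : ℕ → ℝ → ℝ → ℂ := fun n ξ u => ee ξ (p n + R * u) - avg a (fun v => ee ξ (p n + R * v)) with hY
  have hce : ∀ n ξ, Continuous (fun u => ee ξ (p n + R * u)) := fun n ξ =>
    (continuous_ee ξ).comp (by fun_prop)
  have hYc : ∀ n ξ, Continuous (Y n ξ) := fun n ξ => (hce n ξ).sub continuous_const
  have hYb : ∀ n ξ u, ‖Y n ξ u‖ ≤ 2 := by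
    intro n ξ u
    refine (norm_sub_le _ _).trans ?_
    have := norm_avg_le ha (g := fun v => ee ξ (p n + R * v)) (C := 1) (fun v _ => by simp)
    rw [norm_ee]; linarith
  have hY0 : ∀ n ξ, ∫ u in (0:ℝ)..a, Y n ξ u = 0 := by
    intro n ξ
    simp only [hY]
    rw [intervalIntegral.integral_sub ((hce n ξ).intervalIntegrable _ _) (by simp)]
    rw [intervalIntegral.integral_const, avg, sub_zero]
    have : (a : ℂ) ≠ 0 := by exact_mod_cast ha.ne'
    rw [Complex.real_smul]; field_simp; ring
  have hlip : ∀ n ξ η, ∀ u ∈ Set.Icc 0 a, ‖Y n ξ u - Y n η u‖ ≤ 4 * Real.pi * |ξ - η| := by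
    intro n ξ η u hu
    have key : ∀ v ∈ Set.Icc 0 a, ‖ee ξ (p n + R * v) - ee η (p n + R * v)‖ ≤ 2 * Real.pi * |ξ - η| := by
      intro v hv
      refine (norm_ee_sub_le _ _ _).trans ?_
      have h1 : |p n + R * v| ≤ 1 := by
        rw [abs_of_nonneg (add_nonneg (hp0 n) (mul_nonneg hR hv.1))]
        have := mul_le_mul_of_nonneg_left hv.2 hR
        linarith [hp1 n]
      have := Real.pi_pos
      calc _ ≤ 2 * Real.pi * 1 * |ξ - η| := by gcongr
        _ = _ := by ring
    have h1 := key u hu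
    have h2 := norm_avg_le ha key
    rw [avg_sub (hce n ξ) (hce n η)] at h2
    have : Y n ξ u - Y n η u = (ee ξ (p n + R * u) - ee η (p n + R * u))
      - (avg a (fun v => ee ξ (p n + R * v)) - avg a (fun v => ee η (p n + R * v))) := by
      simp only [hY]; ring
    rw [this]
    refine (norm_sub_le _ _).trans ?_
    linarith
  have hm0 : (0:ℝ) < m := by exact_mod_cast hm
  have hm1 : (1:ℝ) ≤ m := by exact_mod_cast hm
  have hN1 : (1:ℝ) ≤ N := by exact_mod_cast hN
  have hs : (1:ℝ) ≤ √m := by rw [Real.one_le_sqrt]; exact hm1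
  have hss : √(m:ℝ) ^ 2 = m := Real.sq_sqrt hm0.le
  set G : Finset (ℤ × Fin 4) := Finset.Icc (-(m * N : ℤ)) (m * N) ×ˢ Finset.univ with hG
  have hcard : (G.card : ℝ) ≤ 12 * m * N := by
    rw [hG, Finset.card_product]
    simp only [Int.card_Icc, Finset.card_univ, Fintype.card_fin]
    have : ((m * N : ℤ) + 1 - -(m * N : ℤ)).toNat = 2 * (m * N) + 1 := by
      have : (m * N : ℤ) + 1 - -(m * N : ℤ) = ((2 * (m * N) + 1 : ℕ) : ℤ) := by push_cast; ring
      rw [this, Int.toNat_natCast]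
    rw [this]; push_cast
    nlinarith [mul_le_mul hm1 hN1 zero_le_one hm0.le]
  obtain ⟨y, hy, hS⟩ := greedy G ha
    (fun n g u => (Complex.I ^ (g.2 : ℕ) * Y n ((g.1 : ℝ) / m) u).re)
    (fun n g => Complex.continuous_re.comp (continuous_const.mul (hYc n _)))
    (fun n g u => (Complex.abs_re_le_norm _).trans (by
      rw [norm_mul, norm_pow, Complex.norm_I, one_pow, one_mul]; exact hYb _ _ _))
    (fun n g => by
      have := Complex.reCLM.intervalIntegral_comp_comm (a := 0) (b := a) (μ := volume)
        (f := fun u => Complex.I ^ (g.2 : ℕ) * Y n ((g.1 : ℝ) / m) u)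
        ((continuous_const.mul (hYc n _)).intervalIntegrable _ _)
      simp only [Complex.reCLM_apply] at this
      rw [this, intervalIntegral.integral_const_mul, hY0]; simp)
    (lam := 1 / (2 * √m)) (by positivity) (by
      rw [div_le_div_iff₀ (by positivity) (by norm_num)]; linarith) m
  refine ⟨y, hy, ?_⟩
  set L := 2 * √m * (Real.log (12 * m * N) + 1) with hL
  have hbd : ∀ g ∈ G, ∑ n ∈ Finset.range m, (Complex.I ^ (g.2 : ℕ) * Y n ((g.1 : ℝ) / m) (y n)).re ≤ L := by
    intro g hg
    have h1 := (Finset.single_le_sum (f := fun g : ℤ × Fin 4 => Real.exp (1 / (2 * √m) * ∑ n ∈ Finset.range m, (Complex.I ^ (g.2 : ℕ) * Y n ((g.1 : ℝ) / m) (y n)).re)) (fun _ _ => (Real.exp_pos _).le) hg).trans hS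
    have h2 : 4 * (1 / (2 * √(m:ℝ))) ^ 2 * m = 1 := by
      rw [div_pow, mul_pow, hss]; field_simp; norm_num
    rw [h2] at h1
    have h3 := h1.trans (mul_le_mul_of_nonneg_right hcard (Real.exp_pos 1).le)
    have hpos : (0:ℝ) < 12 * m * N := by positivity
    rw [← Real.exp_log hpos, ← Real.exp_add, Real.exp_le_exp] at h3
    rw [div_mul_eq_mul_div, one_mul, div_le_iff₀ (by positivity)] at h3
    rw [hL]; linarith
  have hgrid : ∀ i : ℤ, i ∈ Finset.Icc (-(m * N : ℤ)) (m * N) →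
      ‖∑ n ∈ Finset.range m, Y n ((i : ℝ) / m) (y n)‖ ≤ 2 * L := by
    intro i hi
    set z := ∑ n ∈ Finset.range m, Y n ((i : ℝ) / m) (y n) with hz
    have hk : ∀ k : Fin 4, (Complex.I ^ (k : ℕ) * z).re ≤ L := by
      intro k
      have := hbd (i, k) (by rw [hG]; exact Finset.mem_product.2 ⟨hi, Finset.mem_univ _⟩)
      rwa [← Complex.re_sum, ← Finset.mul_sum] at this
    have h0 := hk 0
    have h1 := hk 1
    have h2 := hk 2
    have h3 := hk 3
    simp [pow_succ] at h0 h1 h2 h3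
    refine (Complex.norm_le_abs_re_add_abs_im z).trans ?_
    have : |z.re| ≤ L := abs_le.2 ⟨by linarith, h0⟩
    have : |z.im| ≤ L := abs_le.2 ⟨by linarith, h3⟩
    linarith
  intro ξ hξ
  set i : ℤ := ⌊ξ * m⌋ with hi
  have hξ' := abs_le.1 hξ
  have hiG : i ∈ Finset.Icc (-(m * N : ℤ)) (m * N) := by
    rw [Finset.mem_Icc]
    constructor
    · rw [hi, Int.le_floor]; push_cast; nlinarith
    · have : (i : ℝ) ≤ m * N := (Int.floor_le _).trans (by nlinarith)
      exact_mod_cast this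
  have hd : |ξ - i / m| ≤ 1 / m := by
    have h1 := Int.floor_le (ξ * m)
    have h2 := Int.lt_floor_add_one (ξ * m)
    have : ξ - i / m = (ξ * m - i) / m := by field_simp
    rw [this, abs_div, abs_of_pos hm0]
    gcongr
    rw [abs_le]; constructor <;> linarith
  have h1 : ‖∑ n ∈ Finset.range m, Y n ξ (y n) - ∑ n ∈ Finset.range m, Y n ((i : ℝ) / m) (y n)‖
      ≤ 4 * Real.pi := by
    rw [← Finset.sum_sub_distrib]
    refine (norm_sum_le _ _).trans ?_
    calc _ ≤ ∑ n ∈ Finset.range m, 4 * Real.pi * (1 / m) := by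
          apply Finset.sum_le_sum; intro n _
          refine (hlip n ξ _ _ (hy n)).trans ?_
          have := Real.pi_pos
          gcongr
      _ = 4 * Real.pi := by simp; field_simp
  have h2 := hgrid i hiG
  have h3 := norm_le_norm_add_norm_sub' (∑ n ∈ Finset.range m, Y n ξ (y n)) (∑ n ∈ Finset.range m, Y n ((i : ℝ) / m) (y n))
  calc _ ≤ _ := h3
    _ ≤ 2 * L + 4 * Real.pi := by linarith
    _ = _ := by rw [hL]; ring

end ChenSharp

namespace ChenSharp

noncomputable def mhat (a η : ℝ) : ℂ := (1 / 2) * (1 + ee η (1 / 2)) * avg a (ee η)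

lemma norm_half_le (η : ℝ) : ‖(1 / 2 : ℂ) * (1 + ee η (1 / 2))‖ ≤ 1 := by
  rw [norm_mul]
  have := norm_add_le (1 : ℂ) (ee η (1 / 2))
  rw [norm_ee, norm_one] at this
  have h : ‖(1 / 2 : ℂ)‖ = 1 / 2 := by norm_num
  rw [h]; linarith

lemma norm_mhat_le_one {a : ℝ} (ha : 0 < a) (η : ℝ) : ‖mhat a η‖ ≤ 1 := by
  unfold mhat
  rw [norm_mul]
  have h1 := norm_half_le η
  have h2 := norm_avg_le ha (g := ee η) (C := 1) (fun v _ => by simp)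
  exact mul_le_one₀ h1 (norm_nonneg _) h2

lemma norm_mhat_le {a : ℝ} (ha : 0 < a) {η : ℝ} (hη : η ≠ 0) : ‖mhat a η‖ ≤ 1 / (a * |η|) := by
  unfold mhat
  rw [norm_mul]
  have h1 := norm_half_le η
  have h2 : ‖avg a (ee η)‖ ≤ 1 / (a * |η|) := by
    unfold avg
    set c : ℂ := -(2 * (Real.pi : ℂ) * Complex.I * (η : ℂ)) with hc
    have hcn : ‖c‖ = 2 * Real.pi * |η| := by
      rw [hc]; simp [abs_of_pos Real.pi_pos]
    have hc0 : c ≠ 0 := by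
      rw [← norm_pos_iff, hcn]; have := Real.pi_pos; have := abs_pos.2 hη; positivity
    have : ∫ u in (0:ℝ)..a, ee η u = (Complex.exp (c * a) - Complex.exp (c * (0:ℝ))) / c := by
      rw [← integral_exp_mul_complex hc0]
      congr 1; ext u; unfold ee; rw [hc]; congr 1; ring
    rw [this, norm_mul, norm_div, norm_div, hcn, norm_one, Complex.norm_real, Real.norm_eq_abs, abs_of_pos ha]
    have e1 : Complex.exp (c * a) = ee η a := by unfold ee; rw [hc]; congr 1; ring
    have e2 : Complex.exp (c * (0:ℝ)) = ee η 0 := by unfold ee; rw [hc]; congr 1; ring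
    rw [e1, e2]
    have h3 : ‖ee η a - ee η 0‖ ≤ 2 := by
      refine (norm_sub_le _ _).trans ?_; rw [norm_ee, norm_ee]; norm_num
    have hη' := abs_pos.2 hη
    calc _ ≤ 1 / a * (2 / (2 * 1 * |η|)) := by
          have := Real.pi_gt_three
          gcongr; linarith
      _ = _ := by field_simp
  calc _ ≤ 1 * (1 / (a * |η|)) := by gcongr
    _ = _ := one_mul _

lemma sum_range_two_mul {M : Type*} [AddCommMonoid M] (g : ℕ → M) (m : ℕ) :
    ∑ n ∈ Finset.range (2 * m), g n = ∑ k ∈ Finset.range m, (g (2 * k) + g (2 * k + 1)) := by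
  induction m with
  | zero => simp
  | succ m ih =>
    rw [show 2 * (m + 1) = 2 * m + 1 + 1 by ring, Finset.sum_range_succ, Finset.sum_range_succ, ih,
      Finset.sum_range_succ, add_assoc]

noncomputable def ss (f : ℕ → ℕ → ℝ) (j : ℕ) (ξ : ℝ) : ℂ :=
  (1 / 2 ^ j : ℂ) * ∑ n ∈ Finset.range (2 ^ j), ee ξ (f j n)

lemma avg_mul {a : ℝ} (c : ℂ) (g : ℝ → ℂ) : avg a (fun u => c * g u) = c * avg a g := by
  unfold avg; rw [intervalIntegral.integral_const_mul]; ring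

lemma mean_identity {a R ξ : ℝ} (g : ℕ → ℝ) (M : ℕ) :
    ∑ n ∈ Finset.range (2 * M), avg a (fun u => ee ξ (g (n / 2) + R * (((n % 2 : ℕ) : ℝ) / 2) + R * u))
      = 2 * mhat a (R * ξ) * ∑ n ∈ Finset.range M, ee ξ (g n) := by
  rw [sum_range_two_mul, Finset.mul_sum]
  apply Finset.sum_congr rfl
  intro k _
  have h1 : 2 * k / 2 = k := by omega
  have h2 : (2 * k + 1) / 2 = k := by omega
  have h3 : 2 * k % 2 = 0 := by omega
  have h4 : (2 * k + 1) % 2 = 1 := by omega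
  rw [h1, h2, h3, h4]
  have e : ∀ b : ℝ, avg a (fun u => ee ξ (g k + R * b + R * u)) = ee ξ (g k) * ee (R * ξ) b * avg a (ee (R * ξ)) := by
    intro b
    rw [← avg_mul]; congr 1; ext u
    rw [ee_add, ee_add, ee_mul_left, ee_mul_left]
  rw [e, e]; unfold mhat; simp; ring

lemma log_bound {Q : ℕ} (hQ : 1 ≤ Q) : ∃ A : ℝ, 0 ≤ A ∧ ∀ j : ℕ,
    Real.log (12 * (2 ^ (j+1) : ℕ) * (Q ^ (2 * j) : ℕ)) ≤ A * (j + 1) := by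
  have hQ1 : (1:ℝ) ≤ Q := by exact_mod_cast hQ
  have hlQ := Real.log_nonneg hQ1
  have hl2 := Real.log_nonneg (show (1:ℝ) ≤ 2 by norm_num)
  have hl12 := Real.log_nonneg (show (1:ℝ) ≤ 12 by norm_num)
  refine ⟨Real.log 12 + Real.log 2 + 2 * Real.log Q, by positivity, fun j => ?_⟩
  push_cast
  rw [Real.log_mul (by positivity) (by positivity), Real.log_mul (by positivity) (by positivity),
    Real.log_pow, Real.log_pow]
  push_cast
  have hj : (0:ℝ) ≤ j := Nat.cast_nonneg j
  nlinarith [mul_nonneg hj hl12, mul_nonneg hj hlQ]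

lemma eps_bound {A θ : ℝ} (hθ : √(1/2) < θ) : ∃ ε : ℝ, 0 < ε ∧ ∀ j : ℕ,
    A * (j + 1) * √(1/2) ^ j ≤ ε * θ ^ j := by
  have hθ0 : 0 < θ := (Real.sqrt_nonneg _).trans_lt hθ
  set r := √(1/2) / θ with hr
  have hr0 : 0 ≤ r := by positivity
  have hr1 : r < 1 := by rw [hr, div_lt_one hθ0]; exact hθ
  have hs : Tendsto (fun j : ℕ => A * ((j:ℝ) * r ^ j + r ^ j)) atTop (nhds (A * (0 + 0))) :=
    ((tendsto_self_mul_const_pow_of_lt_one hr0 hr1).add (tendsto_pow_atTop_nhds_zero_of_lt_one hr0 hr1)).const_mul A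
  obtain ⟨K, hK⟩ := hs.bddAbove_range
  refine ⟨max K 1, by positivity, fun j => ?_⟩
  have h1 : A * ((j:ℝ) * r ^ j + r ^ j) ≤ K := hK ⟨j, rfl⟩
  have h2 : √(1/2) ^ j = r ^ j * θ ^ j := by rw [hr, ← mul_pow]; congr 1; field_simp
  rw [h2]
  calc _ = (A * ((j:ℝ) * r ^ j + r ^ j)) * θ ^ j := by ring
    _ ≤ _ := by gcongr; exact h1.trans (le_max_left _ _)

lemma tree {ρ θ : ℝ} (hρ0 : 0 < ρ) (hρ : ρ < 1 / 2) (hθ : √(1/2) < θ) :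
    ∃ (f : ℕ → ℕ → ℝ) (ε : ℝ), 0 < ε ∧ (∀ n, f 0 n = 0) ∧
      (∀ j n, ∃ y ∈ Set.Icc 0 ((1 - 2 * ρ) / 4),
        f (j + 1) n = f j (n / 2) + ρ ^ j * (((n % 2 : ℕ) : ℝ) / 2 + y)) ∧
      (∀ j ξ, |ξ| * ρ ^ (2 * j) ≤ 1 →
        ‖ss f (j + 1) ξ - mhat ((1 - 2 * ρ) / 4) (ρ ^ j * ξ) * ss f j ξ‖ ≤ ε * θ ^ j) := by
  set a := (1 - 2 * ρ) / 4 with ha'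
  have ha : 0 < a := by rw [ha']; linarith
  obtain ⟨Q, hQ⟩ := exists_nat_ge (1 / ρ)
  have hQ1 : 1 ≤ Q := by
    have : (0:ℝ) < Q := lt_of_lt_of_le (by positivity) hQ
    exact_mod_cast this
  have hQN : ∀ j, 1 ≤ Q ^ (2 * j) := fun j => Nat.one_le_pow _ _ hQ1
  have H : ∀ (j : ℕ) (g : ℕ → ℝ), ∃ y : ℕ → ℝ, (∀ n, y n ∈ Set.Icc 0 a) ∧
      ((∀ n, 0 ≤ g n ∧ g n + ρ ^ j ≤ 1) → ∀ ξ : ℝ, |ξ| ≤ (Q ^ (2 * j) : ℕ) →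
      ‖∑ n ∈ Finset.range (2 ^ (j+1)), (ee ξ (g (n / 2) + ρ ^ j * (((n % 2 : ℕ) : ℝ) / 2) + ρ ^ j * y n)
        - avg a (fun u => ee ξ (g (n / 2) + ρ ^ j * (((n % 2 : ℕ) : ℝ) / 2) + ρ ^ j * u)))‖
        ≤ 4 * √(2 ^ (j+1) : ℕ) * (Real.log (12 * (2 ^ (j+1) : ℕ) * (Q ^ (2 * j) : ℕ)) + 1) + 4 * Real.pi) := by
    intro j g
    by_cases hg : ∀ n, 0 ≤ g n ∧ g n + ρ ^ j ≤ 1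
    · have hbit : ∀ n : ℕ, (((n % 2 : ℕ) : ℝ)) ≤ 1 := fun n => by
        have : n % 2 ≤ 1 := by omega
        exact_mod_cast this
      obtain ⟨y, hy, hb⟩ := selection ha (R := ρ ^ j) (by positivity) (m := 2 ^ (j+1)) Nat.one_le_two_pow
        (fun n => g (n / 2) + ρ ^ j * (((n % 2 : ℕ) : ℝ) / 2))
        (fun n => add_nonneg (hg _).1 (by positivity))
        (fun n => by
          have h1 := (hg (n / 2)).2
          have h2 : ρ ^ j * (((n % 2 : ℕ) : ℝ) / 2 + a) ≤ ρ ^ j * 1 := by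
            gcongr
            have := hbit n
            rw [ha']; linarith
          linarith)
        (hQN j)
      exact ⟨y, hy, fun _ => hb⟩
    · exact ⟨fun _ => 0, fun _ => ⟨le_rfl, ha.le⟩, fun h => absurd h hg⟩
  choose Y hY1 hY2 using H
  set f : ℕ → ℕ → ℝ := fun j => Nat.rec (motive := fun _ => ℕ → ℝ) (fun _ => 0)
    (fun j g n => g (n / 2) + ρ ^ j * (((n % 2 : ℕ) : ℝ) / 2 + Y j g n)) j with hf
  have hf0 : ∀ n, f 0 n = 0 := fun n => rfl
  have hfs : ∀ j n, f (j + 1) n = f j (n / 2) + ρ ^ j * (((n % 2 : ℕ) : ℝ) / 2 + Y j (f j) n) :=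
    fun j n => rfl
  have hinv : ∀ j n, 0 ≤ f j n ∧ f j n + ρ ^ j ≤ 1 := by
    intro j
    induction j with
    | zero => intro n; simp [hf0]
    | succ j ih =>
      intro n
      have h1 := ih (n / 2)
      have h2 := hY1 j (f j) n
      have hbit : (((n % 2 : ℕ) : ℝ)) ≤ 1 := by
        have : n % 2 ≤ 1 := by omega
        exact_mod_cast this
      rw [hfs]
      have hpos : 0 < ρ ^ j := by positivity
      constructor
      · have := h2.1
        have := h1.1
        positivity
      · have : ρ ^ j * (((n % 2 : ℕ) : ℝ) / 2 + Y j (f j) n + ρ) ≤ ρ ^ j * 1 := by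
          gcongr
          have := h2.2
          rw [ha'] at this; linarith
        rw [pow_succ]; linarith
  obtain ⟨A, hA0, hA⟩ := log_bound hQ1
  obtain ⟨ε, hε, hεb⟩ := eps_bound (A := 4 * (A + 1) + 4 * Real.pi) hθ
  refine ⟨f, ε, hε, hf0, fun j n => ⟨Y j (f j) n, hY1 _ _ _, hfs j n⟩, fun j ξ hξ => ?_⟩
  have hξQ : |ξ| ≤ (Q ^ (2 * j) : ℕ) := by
    push_cast
    have h1 : (1 / ρ) ^ (2 * j) ≤ (Q:ℝ) ^ (2 * j) := by gcongr
    refine le_trans ?_ h1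
    rw [div_pow, one_pow, le_div_iff₀ (by positivity)]; exact hξ
  have hb := hY2 j (f j) (hinv j) ξ hξQ
  rw [Finset.sum_sub_distrib] at hb
  have hm := mean_identity (a := a) (R := ρ ^ j) (ξ := ξ) (f j) (2 ^ j)
  rw [← pow_succ'] at hm
  rw [hm] at hb
  have hfe : ∀ n, f j (n / 2) + ρ ^ j * (((n % 2 : ℕ) : ℝ) / 2) + ρ ^ j * Y j (f j) n = f (j+1) n := by
    intro n; rw [hfs]; ring
  simp only [hfe] at hb
  have hid : ss f (j + 1) ξ - mhat a (ρ ^ j * ξ) * ss f j ξ = (1 / 2 ^ (j+1) : ℂ) *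
      (∑ n ∈ Finset.range (2 ^ (j + 1)), ee ξ (f (j + 1) n)
        - 2 * mhat a (ρ ^ j * ξ) * ∑ n ∈ Finset.range (2 ^ j), ee ξ (f j n)) := by
    unfold ss; rw [pow_succ]; field_simp
  rw [hid, norm_mul]
  have hn : ‖(1 / 2 ^ (j+1) : ℂ)‖ = 1 / 2 ^ (j+1) := by simp
  rw [hn]
  set q := √(1/2) ^ (j+1) with hq
  have hq0 : 0 < q := by positivity
  have hsq : √((2 ^ (j+1) : ℕ) : ℝ) = 1 / q := by
    push_cast
    rw [Real.sqrt_eq_iff_mul_self_eq (by positivity) (by positivity), hq, ← sq, div_pow, ← pow_mul, mul_comm (j+1) 2, pow_mul, Real.sq_sqrt (by norm_num)]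
    rw [one_pow, one_div_pow, one_div_one_div]
  have hq2 : 1 / 2 ^ (j+1) = q ^ 2 := by
    rw [hq, ← pow_mul, mul_comm (j+1) 2, pow_mul, Real.sq_sqrt (by norm_num), one_div_pow]
  have hqle : q ≤ √(1/2) ^ j := by
    rw [hq, pow_succ]
    have : √(1/2) ≤ (1:ℝ) := Real.sqrt_le_iff.2 ⟨by norm_num, by norm_num⟩
    have h0 : (0:ℝ) ≤ √(1/2) ^ j := by positivity
    nlinarith
  have hq1 : q ≤ 1 := hqle.trans (pow_le_one₀ (by positivity) (Real.sqrt_le_iff.2 ⟨by norm_num, by norm_num⟩))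
  have hj : (0:ℝ) ≤ j := Nat.cast_nonneg j
  rw [hsq] at hb
  refine (mul_le_mul_of_nonneg_left hb (by positivity)).trans ?_
  calc
    (1 / 2 ^ (j+1) : ℝ) * (4 * (1 / q) * (Real.log (12 * (2 ^ (j+1) : ℕ) * (Q ^ (2 * j) : ℕ)) + 1) + 4 * Real.pi)
      ≤ q ^ 2 * (4 * (1 / q) * (A * (j + 1) + (j + 1)) + 4 * Real.pi * (1 / q) * (j+1)) := by
      rw [hq2]
      have hpi := Real.pi_pos
      refine mul_le_mul_of_nonneg_left (add_le_add ?_ ?_) (by positivity)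
      · refine mul_le_mul_of_nonneg_left (add_le_add (hA j) (by linarith)) (by positivity)
      · have h1q : 1 ≤ (1 / q) * (j + 1) := by
          have : 1 ≤ 1 / q := by rw [le_div_iff₀ hq0]; linarith
          nlinarith
        have hm := mul_le_mul_of_nonneg_left h1q (by positivity : (0:ℝ) ≤ 4 * Real.pi)
        linarith
    _ = (4 * (A + 1) + 4 * Real.pi) * (j + 1) * q := by field_simp
    _ ≤ (4 * (A + 1) + 4 * Real.pi) * (j + 1) * √(1/2) ^ j := by
      have hpi := Real.pi_pos
      gcongr
    _ ≤ _ := hεb j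

end ChenSharp

namespace ChenSharp

set_option maxHeartbeats 1000000 in
lemma decay_seq {ρ τ K₀ ε : ℝ} (hρ0 : 0 < ρ) (hρ1 : ρ < 1) (hτ0 : 0 < τ) (hτ : τ ≤ 1 / 2)
    (hK₀ : 0 < K₀) (hε : 0 < ε) : ∃ C : ℝ, 0 < C ∧ ∀ (X : ℝ) (s : ℕ → ℝ), 0 < X →
      (∀ j, 0 ≤ s j) → (∀ j, s j ≤ 1) →
      (∀ j, X * ρ ^ (2 * j) ≤ 1 → s (j + 1) ≤ s j + ε * (ρ ^ τ) ^ j) →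
      (∀ j, X * ρ ^ (2 * j) ≤ 1 → s (j + 1) ≤ K₀ / (ρ ^ j * X) * s j + ε * (ρ ^ τ) ^ j) →
      ∃ N, ∀ n, N ≤ n → s n ≤ C * X ^ (-τ) := by
  set θ := ρ ^ τ with hθ
  have hθ0 : 0 < θ := Real.rpow_pos_of_pos hρ0 _
  have hθ1 : θ < 1 := Real.rpow_lt_one hρ0.le hρ1 hτ0
  have hρθ : ρ ≤ θ := by
    calc ρ = ρ ^ (1:ℝ) := (Real.rpow_one ρ).symm
      _ ≤ ρ ^ τ := Real.rpow_le_rpow_of_exponent_ge hρ0 hρ1.le (by linarith)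
  set K := 2 * K₀ / ρ with hK
  have hK0 : 0 < K := by positivity
  set B := 2 * ε / θ with hB
  have hB0 : 0 < B := by positivity
  set X₀ := max 1 (max K (K ^ 2)) with hX₀
  have hX₀1 : 1 ≤ X₀ := le_max_left _ _
  set C := (B + ε / (1 - θ)) * K ^ τ + K / ρ + X₀ ^ τ with hC
  have h1θ : 0 < 1 - θ := by linarith
  have hCpos : 0 < C := by
    have : 0 < X₀ := by linarith
    positivity
  refine ⟨C, hCpos, ?_⟩
  intro X s hX hs0 hs1 hA hD
  rcases lt_or_ge X X₀ with hlt | hge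
  · refine ⟨0, fun n _ => (hs1 n).trans ?_⟩
    have h1 : X₀ ^ τ * X ^ (-τ) ≤ C * X ^ (-τ) := by
      gcongr
      rw [hC]; have : 0 ≤ (B + ε / (1 - θ)) * K ^ τ + K / ρ := by positivity
      linarith
    refine le_trans ?_ h1
    rw [Real.rpow_neg hX.le, ← div_eq_mul_inv, ← Real.div_rpow (by linarith) hX.le]
    exact Real.one_le_rpow (by rw [le_div_iff₀ hX]; linarith) hτ0.le
  have hX1 : 1 ≤ X := hX₀1.trans hge
  have hXK : K ≤ X := ((le_max_left _ _).trans (le_max_right _ _)).trans hge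
  have hXK2 : K ^ 2 ≤ X := ((le_max_right _ _).trans (le_max_right _ _)).trans hge
  set y := X ^ (-(1/2) : ℝ) with hy
  have hy0 : 0 < y := Real.rpow_pos_of_pos hX _
  have hy1 : y ≤ 1 := Real.rpow_le_one_of_one_le_of_nonpos hX1 (by norm_num)
  have hyy : X * y ^ 2 = 1 := by
    rw [hy, ← Real.rpow_natCast, ← Real.rpow_mul hX.le]
    norm_num
    rw [Real.rpow_neg_one]; field_simp
  obtain ⟨n₀, hn1, hn2⟩ := exists_nat_pow_near_of_lt_one hy0 hy1 hρ0 hρ1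
  obtain ⟨n, hm1, hm2⟩ := exists_nat_pow_near_of_lt_one (x := K / X) (by positivity)
    (by rw [div_le_one hX]; exact hXK) hρ0 hρ1
  have hKy : K / X ≤ y := by
    rw [div_le_iff₀ hX]
    -- K ≤ y X, i.e. K^2 ≤ X
    have : (y * X) ^ 2 = X := by
      calc (y * X) ^ 2 = (X * y ^ 2) * X := by ring
        _ = X := by rw [hyy, one_mul]
    nlinarith [mul_pos hy0 hX]
  have hle : n₀ + 1 ≤ n + 1 := by
    have : ρ ^ (n+1) < ρ ^ n₀ := hm1.trans_le (hKy.trans hn2)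
    have := (pow_lt_pow_iff_right_of_lt_one₀ hρ0 hρ1).1 this
    omega
  set j₀ := n₀ + 1 with hj₀
  have hval : ∀ j, j₀ ≤ j → X * ρ ^ (2 * j) ≤ 1 := by
    intro j hj
    have h1 : ρ ^ j ≤ ρ ^ j₀ := pow_le_pow_of_le_one hρ0.le hρ1.le hj
    have h2 : ρ ^ j ≤ y := h1.trans hn1.le
    rw [mul_comm 2 j, pow_mul]
    calc X * (ρ ^ j) ^ 2 ≤ X * y ^ 2 := by gcongr
      _ = 1 := hyy
  have hclaim : ∀ k, j₀ + k ≤ n + 1 → s (j₀ + k) ≤ B * θ ^ (j₀ + k) + ρ ^ k := by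
    intro k
    induction k with
    | zero => intro _; have := hs1 j₀; simp only [add_zero, pow_zero]; have : 0 < B * θ ^ j₀ := by positivity
              linarith
    | succ k ih =>
      intro hk
      have h1 := ih (by omega)
      have h2 := hD (j₀ + k) (hval _ (by omega))
      have h3 : K ≤ ρ ^ (j₀ + k) * X := by
        have : ρ ^ n ≤ ρ ^ (j₀ + k) := pow_le_pow_of_le_one hρ0.le hρ1.le (by omega)
        rw [div_le_iff₀ hX] at hm2
        exact hm2.trans (by gcongr)
      have h4 : K₀ / (ρ ^ (j₀ + k) * X) ≤ ρ / 2 := by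
        calc _ ≤ K₀ / K := by gcongr
          _ = ρ / 2 := by rw [hK]; field_simp
      have h5 : 0 < θ ^ (j₀ + k) := by positivity
      have h6 : 0 < ρ ^ k := by positivity
      rw [← add_assoc]
      calc s (j₀ + k + 1) ≤ ρ / 2 * (B * θ ^ (j₀ + k) + ρ ^ k) + ε * θ ^ (j₀ + k) := by
            refine h2.trans ?_
            gcongr
            exact hs0 _
        _ ≤ θ / 2 * (B * θ ^ (j₀ + k)) + ρ * ρ ^ k + ε * θ ^ (j₀ + k) := by
            have : ρ / 2 * (B * θ ^ (j₀ + k)) ≤ θ / 2 * (B * θ ^ (j₀ + k)) := by gcongr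
            nlinarith
        _ = B * θ ^ (j₀ + k + 1) + ρ ^ (k + 1) := by
            rw [hB, pow_succ, pow_succ]; field_simp; ring
  obtain ⟨k, hk⟩ : ∃ k, n + 1 = j₀ + k := ⟨n + 1 - j₀, by omega⟩
  have hJ := hclaim k hk.ge
  rw [← hk] at hJ
  set J := n + 1 with hJdef
  have htail : ∀ i, s (J + i) ≤ s J + ε * θ ^ J * ((1 - θ ^ i) / (1 - θ)) := by
    intro i
    induction i with
    | zero => simp
    | succ i ih =>
      have h2 := hA (J + i) (hval _ (by omega))
      rw [← add_assoc]
      refine h2.trans ?_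
      have : ε * θ ^ J * ((1 - θ ^ (i+1)) / (1 - θ)) = ε * θ ^ J * ((1 - θ ^ i) / (1 - θ)) + ε * θ ^ (J + i) := by
        rw [pow_succ, pow_add]; field_simp; ring
      linarith
  refine ⟨J, fun n' hn' => ?_⟩
  obtain ⟨i, rfl⟩ := Nat.exists_eq_add_of_le hn'
  have h1 := htail i
  have h2 : ε * θ ^ J * ((1 - θ ^ i) / (1 - θ)) ≤ ε / (1 - θ) * θ ^ J := by
    have : 0 < θ ^ i := by positivity
    calc _ ≤ ε * θ ^ J * (1 / (1 - θ)) := by gcongr; linarith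
      _ = _ := by ring
  have h3 : θ ^ J ≤ K ^ τ * X ^ (-τ) := by
    have : θ ^ J = (ρ ^ J) ^ τ := by
      rw [hθ, ← Real.rpow_natCast, ← Real.rpow_natCast, ← Real.rpow_mul hρ0.le, ← Real.rpow_mul hρ0.le, mul_comm]
    rw [this, Real.rpow_neg hX.le, ← div_eq_mul_inv, ← Real.div_rpow hK0.le hX.le]
    exact Real.rpow_le_rpow (by positivity) hm1.le hτ0.le
  have h4 : ρ ^ k ≤ K / ρ * X ^ (-τ) := by
    have e1 : ρ ^ J = ρ ^ j₀ * ρ ^ k := by rw [hk, pow_add]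
    have e2 : ρ * y ≤ ρ ^ j₀ := by rw [hj₀, pow_succ, mul_comm]; gcongr
    have e3 : ρ * y * ρ ^ k ≤ K / X := by
      refine le_trans ?_ hm1.le
      rw [e1]; gcongr
    have e4 : K / X = K * y * y := by
      rw [div_eq_iff hX.ne']; calc K = K * (X * y^2) := by rw [hyy, mul_one]
        _ = _ := by ring
    have e5 : ρ ^ k ≤ K / ρ * y := by
      rw [e4] at e3
      have : ρ * ρ ^ k ≤ K * y := by
        refine le_of_mul_le_mul_right ?_ hy0
        calc ρ * ρ ^ k * y = ρ * y * ρ ^ k := by ring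
          _ ≤ _ := e3
      rw [div_mul_eq_mul_div, le_div_iff₀ hρ0]; linarith
    refine e5.trans ?_
    gcongr
    exact Real.rpow_le_rpow_of_exponent_le hX1 (by linarith)
  have hXt : 0 < X ^ (-τ) := Real.rpow_pos_of_pos hX _
  have hX0t : 0 < X₀ ^ τ := Real.rpow_pos_of_pos (by linarith) _
  calc s (J + i) ≤ (B + ε / (1 - θ)) * θ ^ J + ρ ^ k := by linarith
    _ ≤ (B + ε / (1 - θ)) * (K ^ τ * X ^ (-τ)) + K / ρ * X ^ (-τ) := by gcongr
    _ = ((B + ε / (1 - θ)) * K ^ τ + K / ρ) * X ^ (-τ) := by ring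
    _ ≤ C * X ^ (-τ) := by gcongr; rw [hC]; linarith

end ChenSharp

namespace ChenSharp

/-- Fourier transform of a measure. -/
noncomputable def fhat (m : Measure ℝ) (ξ : ℝ) : ℂ := ∫ x, ee ξ x ∂m

def UpReg (m : Measure ℝ) (α C : ℝ) : Prop :=
  ∀ x r : ℝ, 0 < r → m (Set.Icc (x - r) (x + r)) ≤ ENNReal.ofReal (C * r ^ α)

def LoReg (m : Measure ℝ) (α c : ℝ) : Prop :=
  ∀ᵐ x ∂m, ∀ r : ℝ, 0 < r → r ≤ 1 → ENNReal.ofReal (c * r ^ α) ≤ m (Set.Icc (x - r) (x + r))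

def Dec (m : Measure ℝ) (τ C : ℝ) : Prop :=
  ∀ ξ : ℝ, ξ ≠ 0 → ‖fhat m ξ‖ ≤ C * |ξ| ^ (-τ)

section tree

variable {ρ : ℝ} {f : ℕ → ℕ → ℝ}

noncomputable def XX (f : ℕ → ℕ → ℝ) (j : ℕ) (u : ℝ) : ℝ := f j ⌊2 ^ j * u⌋₊

noncomputable def xx (f : ℕ → ℕ → ℝ) (u : ℝ) : ℝ := ⨆ j, XX f j u

def TreeProp (ρ : ℝ) (f : ℕ → ℕ → ℝ) : Prop :=
  (∀ n, f 0 n = 0) ∧ ∀ j n, ∃ y ∈ Set.Icc (0:ℝ) ((1 - 2 * ρ) / 4),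
    f (j+1) n = f j (n/2) + ρ ^ j * (((n % 2 : ℕ) : ℝ) / 2 + y)

lemma floor_half (j : ℕ) (u : ℝ) : ⌊2 ^ (j+1) * u⌋₊ / 2 = ⌊2 ^ j * u⌋₊ := by
  have := Nat.floor_div_natCast (2 ^ (j+1) * u) 2
  rw [← this]
  congr 1
  push_cast
  ring

lemma XX_step (hf : TreeProp ρ f) (j : ℕ) (u : ℝ) :
    ∃ y ∈ Set.Icc (0:ℝ) ((1 - 2 * ρ) / 4),
      XX f (j+1) u = XX f j u + ρ ^ j * (((⌊2 ^ (j+1) * u⌋₊ % 2 : ℕ) : ℝ) / 2 + y) := by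
  obtain ⟨y, hy, h⟩ := hf.2 j ⌊2 ^ (j+1) * u⌋₊
  refine ⟨y, hy, ?_⟩
  rw [floor_half] at h
  exact h

lemma XX_mono (hρ0 : 0 < ρ) (hf : TreeProp ρ f) (u : ℝ) : Monotone fun j => XX f j u := by
  refine monotone_nat_of_le_succ fun j => ?_
  obtain ⟨y, hy, h⟩ := XX_step hf j u
  rw [h]
  have : 0 ≤ ρ ^ j * (((⌊2 ^ (j+1) * u⌋₊ % 2 : ℕ) : ℝ) / 2 + y) := by
    have := hy.1
    positivity
  linarith

lemma XX_anti (hρ0 : 0 < ρ) (hρ : ρ < 1 / 2) (hf : TreeProp ρ f) (u : ℝ) :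
    Antitone fun j => XX f j u + ρ ^ j := by
  refine antitone_nat_of_succ_le fun j => ?_
  obtain ⟨y, hy, h⟩ := XX_step hf j u
  rw [h]
  have h1 : ((⌊2 ^ (j+1) * u⌋₊ % 2 : ℕ) : ℝ) ≤ 1 := by
    have : ⌊2 ^ (j+1) * u⌋₊ % 2 ≤ 1 := by omega
    exact_mod_cast this
  have h2 := hy.2
  have h3 : 0 < ρ ^ j := by positivity
  have : ρ ^ j * (((⌊2 ^ (j+1) * u⌋₊ % 2 : ℕ) : ℝ) / 2 + y) ≤ ρ ^ j * (1 - ρ) := by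
    apply mul_le_mul_of_nonneg_left _ h3.le
    linarith
  have h4 : ρ ^ (j+1) = ρ ^ j * ρ := pow_succ _ _
  linarith

lemma XX_le_xx_aux (hρ0 : 0 < ρ) (hρ : ρ < 1 / 2) (hf : TreeProp ρ f) (u : ℝ) (j k : ℕ) :
    XX f k u ≤ XX f j u + ρ ^ j := by
  have h1 : XX f k u ≤ XX f (max j k) u := XX_mono hρ0 hf u (le_max_right _ _)
  have h2 : XX f (max j k) u + ρ ^ (max j k) ≤ XX f j u + ρ ^ j := XX_anti hρ0 hρ hf u (le_max_left _ _)
  have h3 : 0 < ρ ^ (max j k) := by positivity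
  linarith

lemma XX_le_xx (hρ0 : 0 < ρ) (hρ : ρ < 1 / 2) (hf : TreeProp ρ f) (u : ℝ) (j : ℕ) :
    XX f j u ≤ xx f u :=
  le_ciSup (f := fun j => XX f j u) ⟨XX f j u + ρ ^ j, by
    rintro _ ⟨k, rfl⟩; exact XX_le_xx_aux hρ0 hρ hf u j k⟩ j

lemma xx_le (hρ0 : 0 < ρ) (hρ : ρ < 1 / 2) (hf : TreeProp ρ f) (u : ℝ) (j : ℕ) :
    xx f u ≤ XX f j u + ρ ^ j :=
  ciSup_le fun k => XX_le_xx_aux hρ0 hρ hf u j k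

lemma xx_mem (hρ0 : 0 < ρ) (hρ : ρ < 1 / 2) (hf : TreeProp ρ f) (u : ℝ) :
    xx f u ∈ Set.Icc (0:ℝ) 1 := by
  have h1 := XX_le_xx hρ0 hρ hf u 0
  have h2 := xx_le hρ0 hρ hf u 0
  have h3 : XX f 0 u = 0 := hf.1 _
  rw [h3] at h1 h2
  exact ⟨h1, by simpa using h2⟩

lemma measurable_XX (j : ℕ) : Measurable (XX f j) := by
  unfold XX
  have h : Measurable fun u : ℝ => ⌊2 ^ j * u⌋₊ := Nat.measurable_floor.comp (measurable_const_mul _)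
  exact (Measurable.of_discrete (f := f j)).comp h

lemma measurable_xx : Measurable (xx f) := by
  unfold xx
  exact Measurable.iSup fun j => measurable_XX j

lemma xx_sep (hρ0 : 0 < ρ) (hρ : ρ < 1 / 2) (hf : TreeProp ρ f) {u v : ℝ} {j : ℕ}
    (h0 : ⌊2 ^ j * u⌋₊ = ⌊2 ^ j * v⌋₊) (h1 : ⌊2 ^ (j+1) * u⌋₊ < ⌊2 ^ (j+1) * v⌋₊) :
    (1 - 2 * ρ) / 4 * ρ ^ j ≤ |xx f u - xx f v| := by
  have e1 := floor_half j u
  have e2 := floor_half j v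
  have m1 : ⌊2 ^ (j+1) * u⌋₊ % 2 = 0 := by omega
  have m2 : ⌊2 ^ (j+1) * v⌋₊ % 2 = 1 := by omega
  obtain ⟨y, hy, h⟩ := XX_step hf j u
  obtain ⟨y', hy', h'⟩ := XX_step hf j v
  rw [m1] at h
  rw [m2] at h'
  have hX : XX f j u = XX f j v := by unfold XX; rw [h0]
  have a1 := xx_le hρ0 hρ hf u (j+1)
  have a2 := XX_le_xx hρ0 hρ hf v (j+1)
  have h3 : 0 < ρ ^ j := by positivity
  rw [abs_sub_comm]
  refine le_trans ?_ (le_abs_self _)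
  rw [pow_succ] at a1
  push_cast at h h'
  have b1 : ρ ^ j * y ≤ ρ ^ j * ((1 - 2 * ρ) / 4) := by gcongr; exact hy.2
  have b2 : 0 ≤ ρ ^ j * y' := mul_nonneg h3.le hy'.1
  nlinarith

lemma xx_sep' (hρ0 : 0 < ρ) (hρ : ρ < 1 / 2) (hf : TreeProp ρ f) {u v : ℝ} (hu : u ∈ Set.Ico (0:ℝ) 1)
    (hv : v ∈ Set.Ico (0:ℝ) 1) {j : ℕ} (h : |xx f u - xx f v| < (1 - 2 * ρ) / 4 * ρ ^ j) :
    ⌊2 ^ (j+1) * u⌋₊ = ⌊2 ^ (j+1) * v⌋₊ := by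
  have : ∀ i, i ≤ j + 1 → ⌊2 ^ i * u⌋₊ = ⌊2 ^ i * v⌋₊ := by
    intro i
    induction i with
    | zero =>
      intro _
      rw [pow_zero, one_mul, one_mul, Nat.floor_eq_zero.2 hu.2, Nat.floor_eq_zero.2 hv.2]
    | succ i ih =>
      intro hi
      have h0 := ih (by omega)
      have hp : ρ ^ j ≤ ρ ^ i := pow_le_pow_of_le_one hρ0.le (by linarith) (by omega)
      have ha : 0 < (1 - 2 * ρ) / 4 := by linarith
      have hp2 := mul_le_mul_of_nonneg_left hp ha.le
      rcases lt_trichotomy ⌊2 ^ (i+1) * u⌋₊ ⌊2 ^ (i+1) * v⌋₊ with h1 | h1 | h1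
      · have := xx_sep hρ0 hρ hf h0 h1; linarith
      · exact h1
      · have := xx_sep hρ0 hρ hf h0.symm h1
        rw [abs_sub_comm] at this; linarith
  exact this _ le_rfl

noncomputable def sig (f : ℕ → ℕ → ℝ) : Measure ℝ := (volume.restrict (Set.Ico (0:ℝ) 1)).map (xx f)

instance : IsProbabilityMeasure (volume.restrict (Set.Ico (0:ℝ) 1)) := ⟨by simp⟩

instance : IsProbabilityMeasure (sig f) :=
  Measure.isProbabilityMeasure_map measurable_xx.aemeasurable

lemma sig_apply {s : Set ℝ} (hs : MeasurableSet s) :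
    sig f s = volume (xx f ⁻¹' s ∩ Set.Ico (0:ℝ) 1) := by
  rw [sig, Measure.map_apply measurable_xx hs, Measure.restrict_apply (measurable_xx hs)]

lemma dyadic_vol (j n : ℕ) :
    volume (Set.Ico ((n:ℝ) / 2 ^ j) ((n+1:ℝ) / 2 ^ j)) = ENNReal.ofReal (1 / 2 ^ j) := by
  rw [Real.volume_Ico]; congr 1; ring

lemma mem_dyadic {j : ℕ} {u : ℝ} (hu : 0 ≤ u) {n : ℕ} :
    ⌊2 ^ j * u⌋₊ = n ↔ u ∈ Set.Ico ((n:ℝ) / 2 ^ j) ((n+1:ℝ) / 2 ^ j) := by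
  rw [Nat.floor_eq_iff (by positivity), Set.mem_Ico, div_le_iff₀ (by positivity),
    lt_div_iff₀ (by positivity), mul_comm]

lemma sig_up (hρ0 : 0 < ρ) (hρ : ρ < 1 / 2) (hf : TreeProp ρ f) (x r : ℝ) (j : ℕ)
    (hr : 2 * r < (1 - 2 * ρ) / 4 * ρ ^ j) :
    sig f (Set.Icc (x - r) (x + r)) ≤ ENNReal.ofReal (1 / 2 ^ (j+1)) := by
  rw [sig_apply measurableSet_Icc]
  rcases Set.eq_empty_or_nonempty (xx f ⁻¹' (Set.Icc (x - r) (x + r)) ∩ Set.Ico (0:ℝ) 1) with h | ⟨u, hu⟩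
  · rw [h]; simp
  · rw [← dyadic_vol (j+1) ⌊2 ^ (j+1) * u⌋₊]
    refine measure_mono fun v hv => ?_
    rw [← mem_dyadic hv.2.1]
    refine xx_sep' hρ0 hρ hf hv.2 hu.2 (lt_of_le_of_lt ?_ hr)
    have h1 := hu.1
    have h2 := hv.1
    simp only [Set.mem_preimage, Set.mem_Icc] at h1 h2
    rw [abs_le]; constructor <;> linarith

lemma sig_lo (hρ0 : 0 < ρ) (hρ : ρ < 1 / 2) (hf : TreeProp ρ f) {u : ℝ} (hu : u ∈ Set.Ico (0:ℝ) 1)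
    (r : ℝ) (j : ℕ) (hr : ρ ^ j ≤ r) :
    ENNReal.ofReal (1 / 2 ^ j) ≤ sig f (Set.Icc (xx f u - r) (xx f u + r)) := by
  rw [sig_apply measurableSet_Icc, ← dyadic_vol j ⌊2 ^ j * u⌋₊]
  refine measure_mono fun v hv => ?_
  have hv0 : 0 ≤ v := le_trans (by positivity) hv.1
  have hv1 : v < 1 := by
    refine hv.2.trans_le ?_
    rw [div_le_one (by positivity)]
    have : ⌊2 ^ j * u⌋₊ < 2 ^ j := by
      rw [Nat.floor_lt (by have := hu.1; positivity)]
      push_cast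
      have : (0:ℝ) < 2 ^ j := by positivity
      nlinarith [hu.2]
    have : ⌊2 ^ j * u⌋₊ + 1 ≤ 2 ^ j := this
    exact_mod_cast this
  refine ⟨?_, hv0, hv1⟩
  rw [← mem_dyadic hv0] at hv
  have hX : XX f j u = XX f j v := by unfold XX; rw [hv]
  have a1 := xx_le hρ0 hρ hf u j
  have a2 := XX_le_xx hρ0 hρ hf u j
  have a3 := xx_le hρ0 hρ hf v j
  have a4 := XX_le_xx hρ0 hρ hf v j
  simp only [Set.mem_preimage, Set.mem_Icc]
  constructor <;> linarith

lemma integral_step (g : ℕ → ℂ) (j : ℕ) (hg : ∀ n, ‖g n‖ ≤ 1) :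
    ∫ u in Set.Ico (0:ℝ) 1, g ⌊2 ^ j * u⌋₊ = (1 / 2 ^ j : ℂ) * ∑ n ∈ Finset.range (2 ^ j), g n := by
  have hm : Measurable fun u : ℝ => g ⌊2 ^ j * u⌋₊ :=
    (Measurable.of_discrete (f := g)).comp (Nat.measurable_floor.comp (measurable_const_mul _))
  have hIntv : ∀ a b : ℝ, IntervalIntegrable (fun u : ℝ => g ⌊2 ^ j * u⌋₊) volume a b := by
    intro a b
    rw [intervalIntegrable_iff]
    have : IsFiniteMeasure (volume.restrict (Set.uIoc a b)) :=
      ⟨by simp [Set.uIoc]⟩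
    exact Integrable.of_bound (C := 1) hm.aestronglyMeasurable (Eventually.of_forall fun u => hg _)
  rw [integral_Ico_eq_integral_Ioc, ← intervalIntegral.integral_of_le zero_le_one]
  have h := intervalIntegral.sum_integral_adjacent_intervals (f := fun u : ℝ => g ⌊2 ^ j * u⌋₊)
    (μ := volume) (a := fun k : ℕ => (k:ℝ) / 2 ^ j) (n := 2 ^ j) (fun k _ => hIntv _ _)
  have e1 : (((2 ^ j : ℕ) : ℝ) / 2 ^ j) = 1 := by push_cast; field_simp
  simp only [e1, Nat.cast_zero, zero_div] at h
  rw [← h, Finset.mul_sum]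
  refine Finset.sum_congr rfl fun n _ => ?_
  rw [intervalIntegral.integral_of_le (by gcongr; simp), ← integral_Ico_eq_integral_Ioc]
  rw [setIntegral_congr_fun (g := fun _ => g n) measurableSet_Ico]
  · rw [setIntegral_const, Measure.real]
    push_cast
    rw [dyadic_vol, ENNReal.toReal_ofReal (by positivity), Complex.real_smul]
    push_cast; rfl
  · intro u hu
    have hu0 : 0 ≤ u := le_trans (by positivity) hu.1
    push_cast at hu
    have := (mem_dyadic hu0).2 hu
    simp only [this]

lemma fhat_sig_approx (hρ0 : 0 < ρ) (hρ : ρ < 1 / 2) (hf : TreeProp ρ f) (ξ : ℝ) (j : ℕ) :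
    ‖fhat (sig f) ξ - ss f j ξ‖ ≤ 2 * Real.pi * |ξ| * ρ ^ j := by
  have h1 : fhat (sig f) ξ = ∫ u in Set.Ico (0:ℝ) 1, ee ξ (xx f u) := by
    rw [fhat, sig, integral_map measurable_xx.aemeasurable (continuous_ee ξ).aestronglyMeasurable]
  have h2 : ss f j ξ = ∫ u in Set.Ico (0:ℝ) 1, ee ξ (XX f j u) := by
    unfold XX
    rw [integral_step (fun n => ee ξ (f j n)) j (fun n => by simp)]
    rfl
  rw [h1, h2, ← integral_sub]
  · have := norm_integral_le_of_norm_le_const (μ := volume.restrict (Set.Ico (0:ℝ) 1))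
      (f := fun u => ee ξ (xx f u) - ee ξ (XX f j u)) (C := 2 * Real.pi * |ξ| * ρ ^ j)
      (Eventually.of_forall fun u => ?_)
    · simpa using this
    · refine (norm_ee_sub_le' ξ _ _).trans ?_
      have a1 := xx_le hρ0 hρ hf u j
      have a2 := XX_le_xx hρ0 hρ hf u j
      have hpi := Real.pi_pos
      gcongr
      rw [abs_le]; constructor
      · have : 0 < ρ ^ j := by positivity
        linarith
      · linarith
  · refine Integrable.of_bound (C := 1) ((continuous_ee ξ).measurable.comp measurable_xx).aestronglyMeasurable ?_
    exact Eventually.of_forall fun u => by simp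
  · refine Integrable.of_bound (C := 1) ((continuous_ee ξ).measurable.comp (measurable_XX j)).aestronglyMeasurable ?_
    exact Eventually.of_forall fun u => by simp

end tree

lemma norm_ss_le (f : ℕ → ℕ → ℝ) (j : ℕ) (ξ : ℝ) : ‖ss f j ξ‖ ≤ 1 := by
  unfold ss
  rw [norm_mul]
  have hn : ‖(1 / 2 ^ j : ℂ)‖ = 1 / 2 ^ j := by simp
  rw [hn]
  have : ‖∑ n ∈ Finset.range (2 ^ j), ee ξ (f j n)‖ ≤ 2 ^ j := by
    refine (norm_sum_le _ _).trans ?_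
    simp
  calc _ ≤ (1 / 2 ^ j : ℝ) * 2 ^ j := by gcongr
    _ = 1 := by field_simp

set_option maxHeartbeats 1000000 in
theorem base_measure {α τ : ℝ} (hα0 : 0 < α) (hα1 : α < 1) (hτ0 : 0 < τ) (hτ : τ < α / 2) :
    ∃ (σ : Measure ℝ) (c C : ℝ), IsProbabilityMeasure σ ∧ 0 < c ∧ 0 < C ∧ σ (Set.Icc 0 1)ᶜ = 0 ∧
      UpReg σ α C ∧ LoReg σ α c ∧ Dec σ τ C := by
  set ρ : ℝ := 2⁻¹ ^ (1 / α) with hρd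
  have hρ0 : 0 < ρ := by positivity
  have hρα : ρ ^ α = 2⁻¹ := by
    rw [hρd, ← Real.rpow_mul (by norm_num), one_div_mul_cancel hα0.ne', Real.rpow_one]
  have hρ : ρ < 1 / 2 := by
    have : (2⁻¹ : ℝ) ^ (1 / α) < 2⁻¹ ^ (1:ℝ) :=
      Real.rpow_lt_rpow_of_exponent_gt (by norm_num) (by norm_num) (by rw [lt_div_iff₀ hα0]; linarith)
    rw [Real.rpow_one] at this
    rw [hρd]; norm_num at this ⊢; linarith
  have hρ1 : ρ < 1 := by linarith
  have hθ : √(1/2) < ρ ^ τ := by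
    have : √(1/2) = ρ ^ (α / 2) := by
      rw [Real.sqrt_eq_rpow, div_eq_mul_one_div α 2, Real.rpow_mul hρ0.le, hρα]; norm_num
    rw [this]
    exact Real.rpow_lt_rpow_of_exponent_gt hρ0 hρ1 hτ
  obtain ⟨f, ε, hε, hf0, hfs, hfe⟩ := tree hρ0 hρ hθ
  have hf : TreeProp ρ f := ⟨hf0, hfs⟩
  set a := (1 - 2 * ρ) / 4 with ha
  have ha0 : 0 < a := by rw [ha]; linarith
  obtain ⟨C1, hC1, hdec⟩ := decay_seq (K₀ := 1 / a) hρ0 hρ1 hτ0 (by linarith) (by positivity) hε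
  have hpow : ∀ n : ℕ, (1 / 2 ^ n : ℝ) = (ρ ^ n) ^ α := by
    intro n
    rw [← Real.rpow_natCast ρ, ← Real.rpow_mul hρ0.le, mul_comm, Real.rpow_mul hρ0.le, hρα, Real.rpow_natCast]
    rw [inv_pow, one_div]
  refine ⟨sig f, 1 / 4, max C1 (2 * (2 / a) ^ α), inferInstance, by norm_num, lt_max_of_lt_left hC1, ?_, ?_, ?_, ?_⟩
  · rw [sig_apply measurableSet_Icc.compl]
    convert measure_empty (μ := (volume : Measure ℝ))
    ext u
    simp only [Set.mem_inter_iff, Set.mem_preimage, Set.mem_compl_iff, Set.mem_empty_iff_false, iff_false, not_and]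
    intro h; exact absurd (xx_mem hρ0 hρ hf u) h
  · intro x r hr
    have hCle : ENNReal.ofReal (2 * (2 / a) ^ α * r ^ α) ≤ ENNReal.ofReal (max C1 (2 * (2 / a) ^ α) * r ^ α) := by
      apply ENNReal.ofReal_le_ofReal
      gcongr
      exact le_max_right _ _
    refine le_trans ?_ hCle
    have e : 2 * (2 / a) ^ α * r ^ α = 2 * (2 * r / a) ^ α := by
      rw [mul_assoc, ← Real.mul_rpow (by positivity) hr.le]; ring_nf
    rw [e]
    rcases le_or_gt a (2 * r) with h | h
    · refine (prob_le_one).trans ?_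
      rw [← ENNReal.ofReal_one]
      apply ENNReal.ofReal_le_ofReal
      have : 1 ≤ (2 * r / a) ^ α := Real.one_le_rpow (by rw [le_div_iff₀ ha0]; linarith) hα0.le
      linarith
    · obtain ⟨n, h1, h2⟩ := exists_nat_pow_near_of_lt_one (x := 2 * r / a) (by positivity)
        (by rw [div_le_one ha0]; exact h.le) hρ0 hρ1
      have h3 : sig f (Set.Icc (x - r) (x + r)) ≤ ENNReal.ofReal (1 / 2 ^ n) := by
        cases n with
        | zero => simpa using prob_le_one
        | succ k =>
          apply sig_up hρ0 hρ hf
          rw [div_le_iff₀ ha0] at h2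
          have : ρ ^ (k+1) < ρ ^ k := pow_lt_pow_right_of_lt_one₀ hρ0 hρ1 (by omega)
          rw [← ha]
          calc 2 * r ≤ ρ ^ (k+1) * a := h2
            _ < ρ ^ k * a := by gcongr
            _ = _ := by ring
      refine h3.trans (ENNReal.ofReal_le_ofReal ?_)
      have h4 : (ρ ^ (n+1)) ^ α ≤ (2 * r / a) ^ α := Real.rpow_le_rpow (by positivity) h1.le hα0.le
      rw [← hpow] at h4
      have : (1 / 2 ^ n : ℝ) = 2 * (1 / 2 ^ (n+1)) := by rw [pow_succ]; field_simp
      linarith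
  · set D := xx f '' Set.Ico (0:ℝ) 1 with hD
    have hDc : sig f (closure D)ᶜ = 0 := by
      rw [sig_apply isClosed_closure.measurableSet.compl]
      convert measure_empty (μ := (volume : Measure ℝ))
      ext u
      simp only [Set.mem_inter_iff, Set.mem_preimage, Set.mem_compl_iff, Set.mem_empty_iff_false, iff_false, not_and]
      intro h hu; exact h (subset_closure ⟨u, hu, rfl⟩)
    have hDae : ∀ᵐ x ∂(sig f), x ∈ closure D := by rw [ae_iff]; exact hDc
    filter_upwards [hDae] with x hx r hr0 hr1
    obtain ⟨_, ⟨u, hu, rfl⟩, hd⟩ := Metric.mem_closure_iff.1 hx (r/2) (by positivity)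
    rw [Real.dist_eq, abs_lt] at hd
    have hsub : Set.Icc (xx f u - r/2) (xx f u + r/2) ⊆ Set.Icc (x - r) (x + r) :=
      Set.Icc_subset_Icc (by linarith [hd.1]) (by linarith [hd.2])
    refine le_trans ?_ (measure_mono hsub)
    obtain ⟨n, h1, h2⟩ := exists_nat_pow_near_of_lt_one (x := r / 2) (by positivity)
        (by linarith) hρ0 hρ1
    refine le_trans ?_ (sig_lo hρ0 hρ hf hu (r/2) (n+1) h1.le)
    apply ENNReal.ofReal_le_ofReal
    have h4 : (r/2) ^ α ≤ (ρ ^ n) ^ α := Real.rpow_le_rpow (by positivity) h2 hα0.le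
    rw [← hpow, Real.div_rpow hr0.le (by norm_num)] at h4
    have h5 : (2:ℝ) ^ α ≤ 2 := by
      calc (2:ℝ) ^ α ≤ 2 ^ (1:ℝ) := Real.rpow_le_rpow_of_exponent_le (by norm_num) hα1.le
        _ = 2 := Real.rpow_one 2
    have h6 : r ^ α / 2 ≤ r ^ α / 2 ^ α := by gcongr
    have : (1 / 2 ^ n : ℝ) = 2 * (1 / 2 ^ (n+1)) := by rw [pow_succ]; field_simp
    linarith
  · intro ξ hξ
    have hX : 0 < |ξ| := abs_pos.2 hξ
    have hstep : ∀ j, |ξ| * ρ ^ (2 * j) ≤ 1 →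
        ‖ss f (j+1) ξ‖ ≤ ‖mhat a (ρ ^ j * ξ)‖ * ‖ss f j ξ‖ + ε * (ρ ^ τ) ^ j := by
      intro j hj
      have := hfe j ξ hj
      rw [← norm_mul]
      have h2 := norm_sub_norm_le (ss f (j+1) ξ) (mhat a (ρ ^ j * ξ) * ss f j ξ)
      linarith
    obtain ⟨N, hN⟩ := hdec |ξ| (fun j => ‖ss f j ξ‖) hX (fun j => norm_nonneg _) (fun j => norm_ss_le f j ξ)
      (fun j hj => (hstep j hj).trans (by
        have := norm_mhat_le_one ha0 (ρ ^ j * ξ)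
        have h3 := norm_nonneg (ss f j ξ)
        nlinarith))
      (fun j hj => (hstep j hj).trans (by
        have := norm_mhat_le ha0 (η := ρ ^ j * ξ) (by positivity)
        have h3 := norm_nonneg (ss f j ξ)
        rw [abs_mul, abs_of_pos (by positivity : 0 < ρ ^ j)] at this
        have e : 1 / a / (ρ ^ j * |ξ|) = 1 / (a * (ρ ^ j * |ξ|)) := by rw [div_div]
        rw [e]
        gcongr))
    have hlim : Tendsto (fun j => ss f j ξ) atTop (nhds (fhat (sig f) ξ)) := by
      rw [tendsto_iff_norm_sub_tendsto_zero]
      refine squeeze_zero (fun _ => norm_nonneg _) (g := fun j => 2 * Real.pi * |ξ| * ρ ^ j) (fun j => ?_) ?_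
      · rw [norm_sub_rev]; exact fhat_sig_approx hρ0 hρ hf ξ j
      · have := (tendsto_pow_atTop_nhds_zero_of_lt_one hρ0.le hρ1).const_mul (2 * Real.pi * |ξ|)
        simpa using this
    have h1 : ‖fhat (sig f) ξ‖ ≤ C1 * |ξ| ^ (-τ) :=
      le_of_tendsto hlim.norm (eventually_atTop.2 ⟨N, hN⟩)
    refine h1.trans ?_
    gcongr
    exact le_max_left _ _

end ChenSharp

namespace ChenSharp

lemma aff_emb {d : ℝ} (hd : 0 < d) (b : ℝ) : MeasurableEmbedding (fun x : ℝ => d * x + b) :=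
  (affineHomeomorph d b hd.ne').measurableEmbedding

lemma aff_preimage_Icc {d : ℝ} (hd : 0 < d) (b x r : ℝ) :
    (fun y : ℝ => d * y + b) ⁻¹' Set.Icc (x - r) (x + r)
      = Set.Icc ((x - b) / d - r / d) ((x - b) / d + r / d) := by
  ext y
  simp only [Set.mem_preimage, Set.mem_Icc]
  rw [← sub_div, ← add_div, div_le_iff₀ hd, le_div_iff₀ hd]
  constructor <;> rintro ⟨h1, h2⟩ <;> constructor <;> linarith

lemma aff_map_Icc {d : ℝ} (hd : 0 < d) (b x r : ℝ) (m : Measure ℝ) :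
    m.map (fun y : ℝ => d * y + b) (Set.Icc (x - r) (x + r))
      = m (Set.Icc ((x - b) / d - r / d) ((x - b) / d + r / d)) := by
  rw [(aff_emb hd b).map_apply, aff_preimage_Icc hd]

lemma fhat_aff {d : ℝ} (hd : 0 < d) (b ξ : ℝ) (m : Measure ℝ) :
    fhat (m.map (fun y : ℝ => d * y + b)) ξ = fhat m (d * ξ) * ee ξ b := by
  unfold fhat
  rw [(aff_emb hd b).integral_map, ← integral_mul_const]
  simp only [ee_add, ee_mul_left]

lemma UpReg.map {m : Measure ℝ} {α C d : ℝ} (h : UpReg m α C) (hd : 0 < d) (b : ℝ) :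
    UpReg (m.map (fun y : ℝ => d * y + b)) α (C * d ^ (-α)) := by
  intro x r hr
  rw [aff_map_Icc hd]
  convert h ((x - b) / d) (r / d) (by positivity) using 2
  rw [Real.div_rpow hr.le hd.le, Real.rpow_neg hd.le]
  ring

lemma LoReg.map {m : Measure ℝ} {α c d : ℝ} (h : LoReg m α c) (hd : 0 < d) (hd1 : d ≤ 1) (b : ℝ) :
    LoReg (m.map (fun y : ℝ => d * y + b)) α c := by
  unfold LoReg
  rw [(aff_emb hd b).ae_map_iff]
  filter_upwards [h] with x hx r hr hr1
  rw [aff_map_Icc hd]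
  refine (hx r hr hr1).trans (measure_mono ?_)
  have e : (d * x + b - b) / d = x := by field_simp; ring
  rw [e]
  have : r ≤ r / d := by rw [le_div_iff₀ hd]; nlinarith
  exact Set.Icc_subset_Icc (by linarith) (by linarith)

lemma Dec.map {m : Measure ℝ} {τ C d : ℝ} (h : Dec m τ C) (hd : 0 < d) (b : ℝ) :
    Dec (m.map (fun y : ℝ => d * y + b)) τ (C * d ^ (-τ)) := by
  intro ξ hξ
  rw [fhat_aff hd, norm_mul, norm_ee, mul_one]
  refine (h (d * ξ) (by positivity)).trans (le_of_eq ?_)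
  rw [abs_mul, abs_of_pos hd, Real.mul_rpow hd.le (abs_nonneg _)]
  ring

/-- one step of the iterated function system -/
noncomputable def SS (d α s : ℝ) (t : ℕ) (m : Measure ℝ) : Measure ℝ :=
  ENNReal.ofReal (d ^ α) • ∑ a ∈ Finset.range t, m.map (fun x => d * x + a * s)

lemma SS_apply {d : ℝ} (hd : 0 < d) (α s : ℝ) (t : ℕ) (m : Measure ℝ) (B : Set ℝ) :
    SS d α s t m B = ENNReal.ofReal (d ^ α) *
      ∑ a ∈ Finset.range t, m ((fun x => d * x + a * s) ⁻¹' B) := by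
  simp only [SS, Measure.smul_apply, Measure.finsetSum_apply, smul_eq_mul, (aff_emb hd _).map_apply]

lemma SS_sum {d : ℝ} (hd : 0 < d) (α s : ℝ) (t : ℕ) (m : ℕ → Measure ℝ) :
    SS d α s t (Measure.sum m) = Measure.sum fun l => SS d α s t (m l) := by
  ext B hB
  rw [SS_apply hd, Measure.sum_apply _ hB]
  simp only [SS_apply hd]
  rw [ENNReal.tsum_mul_left, Summable.tsum_finsetSum (fun _ _ => ENNReal.summable)]
  congr 1
  refine Finset.sum_congr rfl fun a _ => ?_
  rw [Measure.sum_apply _ ((aff_emb hd _).measurable hB)]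

lemma exists_fixed {d : ℝ} (hd : 0 < d) (α s : ℝ) (t : ℕ) (σ : Measure ℝ) [IsFiniteMeasure σ]
    (hθ : t * d ^ α < 1) :
    ∃ ν : Measure ℝ, IsFiniteMeasure ν ∧ ν = σ + SS d α s t ν := by
  set m : ℕ → Measure ℝ := fun l => (SS d α s t)^[l] σ with hm
  have hms : ∀ l, m (l+1) = SS d α s t (m l) := fun l => Function.iterate_succ_apply' _ _ _
  have hmass : ∀ l, m l Set.univ = ENNReal.ofReal (t * d ^ α) ^ l * σ Set.univ := by
    intro l
    induction l with
    | zero => simp [hm]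
    | succ l ih =>
      rw [hms, SS_apply hd]
      simp only [Set.preimage_univ, ih, Finset.sum_const, Finset.card_range, nsmul_eq_mul]
      rw [ENNReal.ofReal_mul (by positivity), ENNReal.ofReal_natCast]
      ring
  refine ⟨Measure.sum m, ⟨?_⟩, ?_⟩
  · rw [Measure.sum_apply _ MeasurableSet.univ]
    simp only [hmass]
    rw [ENNReal.tsum_mul_right, ENNReal.tsum_geometric]
    refine ENNReal.mul_lt_top ?_ (measure_lt_top _ _)
    rw [ENNReal.inv_lt_top, tsub_pos_iff_lt]
    rw [← ENNReal.ofReal_one]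
    exact (ENNReal.ofReal_lt_ofReal_iff one_pos).2 hθ
  · rw [SS_sum hd]
    ext B hB
    rw [Measure.add_apply, Measure.sum_apply _ hB, Measure.sum_apply _ hB, tsum_eq_zero_add' ENNReal.summable]
    simp only [hms]
    rfl

lemma zero_of_le_mul {p : ENNReal} (hp : p ≠ ⊤) {θ : ℝ} (hθ1 : θ < 1)
    (h : p ≤ ENNReal.ofReal θ * p) : p = 0 := by
  by_contra h0
  have : ENNReal.ofReal θ < 1 := by
    rw [← ENNReal.ofReal_one]; exact (ENNReal.ofReal_lt_ofReal_iff one_pos).2 hθ1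
  have h2 : ENNReal.ofReal θ * p < 1 * p := ENNReal.mul_lt_mul_left h0 hp this
  rw [one_mul] at h2
  exact absurd h (not_le.2 h2)

section piece

variable {d α s : ℝ} {t : ℕ} {σ ν : Measure ℝ}

lemma FE_apply (hd : 0 < d) (hν : ν = σ + SS d α s t ν) (B : Set ℝ) :
    ν B = σ B + ENNReal.ofReal (d ^ α) * ∑ a ∈ Finset.range t, ν ((fun x => d * x + a * s) ⁻¹' B) := by
  conv_lhs => rw [hν]
  rw [Measure.add_apply, SS_apply hd]

lemma FE_null [IsFiniteMeasure ν] (hd : 0 < d) (hν : ν = σ + SS d α s t ν) (hθ : t * d ^ α < 1)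
    (B : Set ℝ) (hσ : σ B = 0)
    (hB : ∀ a, a < t → ∀ x, d * x + (a:ℝ) * s ∈ B → x ∈ B) : ν B = 0 := by
  refine zero_of_le_mul (measure_ne_top ν B) hθ ?_
  conv_lhs => rw [FE_apply hd hν B, hσ, zero_add]
  rw [ENNReal.ofReal_mul (by positivity), ENNReal.ofReal_natCast, mul_comm (t:ENNReal), mul_assoc]
  gcongr
  calc _ ≤ ∑ a ∈ Finset.range t, ν B :=
        Finset.sum_le_sum fun a ha => measure_mono fun x hx => hB a (Finset.mem_range.1 ha) x hx
    _ = _ := by simp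

lemma FE_support [IsFiniteMeasure ν] (hd : 0 < d) (hν : ν = σ + SS d α s t ν) (hθ : t * d ^ α < 1)
    (hs : 0 < s) (hts : t * s ≤ 1 / 8) (hds : d ≤ s / 8) (ht : 1 ≤ t)
    (hσ : σ (Set.Icc (1/2) (3/4))ᶜ = 0) : ν (Set.Icc 0 1)ᶜ = 0 := by
  refine FE_null hd hν hθ _ ?_ ?_
  · refine measure_mono_null ?_ hσ
    exact Set.compl_subset_compl.2 (Set.Icc_subset_Icc (by norm_num) (by norm_num))
  · intro a ha x hx
    rw [Set.mem_compl_iff] at hx ⊢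
    contrapose! hx
    have h1 : (a:ℝ) * s ≤ 1 / 8 := by
      refine le_trans ?_ hts
      gcongr
    have h2 : (0:ℝ) ≤ a * s := by positivity
    have h3 : s ≤ 1 / 8 := by
      have : (1:ℝ) ≤ t := by exact_mod_cast ht
      nlinarith
    have := hx.1
    have := hx.2
    constructor
    · have : 0 ≤ d * x := by positivity
      linarith
    · nlinarith

lemma FE_lower [IsFiniteMeasure ν] (hd : 0 < d) (hα : 0 < α) (hν : ν = σ + SS d α s t ν) (hθ : t * d ^ α < 1)
    (hsupp : ν (Set.Icc 0 1)ᶜ = 0) [IsProbabilityMeasure σ] {c : ℝ} (hc : 0 < c) (hlo : LoReg σ α c) :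
    LoReg ν α (min c (d ^ α)) := by
  have hmain : ∀ᵐ x ∂ν, x ∈ Set.Icc (0:ℝ) 1 ∧ ∀ r : ℝ, 0 < r → r ≤ 1 →
      ENNReal.ofReal ((min c (d ^ α)) * r ^ α) ≤ ν (Set.Icc (x - r) (x + r)) := by
    rw [ae_iff]
    have hgood : ∀ x, x ∈ Set.Icc (0:ℝ) 1 ∧ (∀ r : ℝ, 0 < r → r ≤ 1 →
      ENNReal.ofReal ((min c (d ^ α)) * r ^ α) ≤ ν (Set.Icc (x - r) (x + r))) → ∀ a, a < t → 
      ∀ r : ℝ, 0 < r → r ≤ 1 →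
      ENNReal.ofReal ((min c (d ^ α)) * r ^ α) ≤ ν (Set.Icc (d * x + a * s - r) (d * x + a * s + r)) := by
      rintro x ⟨hx, hx2⟩ a ha r hr hr1
      rw [FE_apply hd hν]
      refine le_trans ?_ le_add_self
      refine le_trans ?_ (mul_le_mul_right (Finset.single_le_sum (f := fun a : ℕ => ν ((fun x => d * x + a * s) ⁻¹' _)) (fun _ _ => zero_le) (Finset.mem_range.2 ha)) _)
      rw [aff_preimage_Icc hd]
      have e : (d * x + a * s - a * s) / d = x := by field_simp; ring
      rw [e]
      rcases le_or_gt r d with hrd | hrd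
      · have h1 := hx2 (r / d) (by positivity) (by rw [div_le_one hd]; exact hrd)
        refine le_trans ?_ (mul_le_mul_right h1 _)
        rw [← ENNReal.ofReal_mul (by positivity)]
        apply ENNReal.ofReal_le_ofReal
        rw [Real.div_rpow hr.le hd.le]
        have : 0 < d ^ α := by positivity
        apply le_of_eq; field_simp
      · have h1 : 1 ≤ ν (Set.Icc (x - r / d) (x + r / d)) := by
          calc 1 = σ Set.univ := measure_univ.symm
            _ ≤ ν Set.univ := by rw [FE_apply hd hν]; exact le_self_add
            _ = ν (Set.Icc 0 1) := (measure_congr (eventuallyEq_univ.2 (by rw [mem_ae_iff]; exact hsupp))).symm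
            _ ≤ _ := by
              apply measure_mono
              have : 1 ≤ r / d := by rw [le_div_iff₀ hd]; linarith
              exact Set.Icc_subset_Icc (by linarith [hx.2]) (by linarith [hx.1])
        refine le_trans ?_ (mul_le_mul_right h1 _)
        rw [mul_one]
        apply ENNReal.ofReal_le_ofReal
        have h3 : r ^ α ≤ 1 := Real.rpow_le_one hr.le hr1 hα.le
        have h4 : min c (d ^ α) ≤ d ^ α := min_le_right _ _
        have : 0 < d ^ α := by positivity
        have : 0 < r ^ α := by positivity
        nlinarith
    have hU : ν {a | ¬(a ∈ Set.Icc (0:ℝ) 1 ∧ ∀ r : ℝ, 0 < r → r ≤ 1 →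
      ENNReal.ofReal ((min c (d ^ α)) * r ^ α) ≤ ν (Set.Icc (a - r) (a + r)))} ≤ 
      ν ({a | ¬(a ∈ Set.Icc (0:ℝ) 1 ∧ ∀ r : ℝ, 0 < r → r ≤ 1 →
      ENNReal.ofReal ((min c (d ^ α)) * r ^ α) ≤ ν (Set.Icc (a - r) (a + r)))} ∩ Set.Icc 0 1) := by
      refine (measure_le_inter_add_sdiff _ _ (Set.Icc 0 1)).trans ?_
      rw [show ν ({a | ¬(a ∈ Set.Icc (0:ℝ) 1 ∧ ∀ r : ℝ, 0 < r → r ≤ 1 →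
      ENNReal.ofReal ((min c (d ^ α)) * r ^ α) ≤ ν (Set.Icc (a - r) (a + r)))} \ Set.Icc 0 1) = 0 from measure_mono_null (fun x hx => hx.2) hsupp, add_zero]
    refine le_antisymm (hU.trans (le_of_eq ?_)) zero_le
    refine zero_of_le_mul (measure_ne_top ν _) hθ ?_
    conv_lhs => rw [FE_apply hd hν]
    have hσ0 : σ ({a | ¬(a ∈ Set.Icc (0:ℝ) 1 ∧ ∀ r : ℝ, 0 < r → r ≤ 1 →
      ENNReal.ofReal ((min c (d ^ α)) * r ^ α) ≤ ν (Set.Icc (a - r) (a + r)))} ∩ Set.Icc 0 1) = 0 := by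
      refine measure_mono_null ?_ (ae_iff.1 hlo)
      rintro x ⟨hx1, hx2⟩ h
      apply hx1
      refine ⟨hx2, fun r hr hr1 => ?_⟩
      rw [FE_apply hd hν]
      refine le_trans ?_ le_self_add
      refine le_trans ?_ (h r hr hr1)
      apply ENNReal.ofReal_le_ofReal
      gcongr
      exact min_le_left _ _
    rw [hσ0, zero_add, ENNReal.ofReal_mul (by positivity), ENNReal.ofReal_natCast, mul_comm (t:ENNReal), mul_assoc]
    refine mul_le_mul_right ?_ _
    refine (Finset.sum_le_sum (g := fun _ => ν ({a | ¬(a ∈ Set.Icc (0:ℝ) 1 ∧ ∀ r : ℝ, 0 < r → r ≤ 1 →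
      ENNReal.ofReal ((min c (d ^ α)) * r ^ α) ≤ ν (Set.Icc (a - r) (a + r)))} ∩ Set.Icc 0 1)) fun a ha => ?_).trans (by simp)
    refine le_trans (measure_mono ?_) hU
    rintro x ⟨hx1, hx2⟩ hx
    exact hx1 ⟨hx2, hgood x hx a (Finset.mem_range.1 ha)⟩
  filter_upwards [hmain] with x hx using hx.2

end piece

end ChenSharp

namespace ChenSharp

section piece

variable {d α s : ℝ} {t : ℕ} {σ ν : Measure ℝ}

lemma FE_one_piece (hd : 0 < d) (hν : ν = σ + SS d α s t ν)
    (hs : 0 < s) (hts : t * s ≤ 1 / 8) (hds : d ≤ s / 8) (hs8 : s ≤ 1 / 8)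
    (hσ : σ (Set.Icc (1/2) (3/4))ᶜ = 0) (hsupp : ν (Set.Icc 0 1)ᶜ = 0) (x r : ℝ) (hr : r < s / 4) :
    ν (Set.Icc (x - r) (x + r)) ≤ σ (Set.Icc (x - r) (x + r)) ∨
    ∃ y, ν (Set.Icc (x - r) (x + r)) ≤ ENNReal.ofReal (d ^ α) * ν (Set.Icc (y - r / d) (y + r / d)) := by
  have hz : ∀ a : ℕ, (x + r < a * s ∨ a * s + d < x - r) →
      ν ((fun y => d * y + a * s) ⁻¹' (Set.Icc (x - r) (x + r))) = 0 := by
    intro a ha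
    refine measure_mono_null ?_ hsupp
    rintro y ⟨hy1, hy2⟩ ⟨hy3, hy4⟩
    have h1 : 0 ≤ d * y := by positivity
    have h2 : d * y ≤ d := by nlinarith
    simp only at hy1 hy2
    rcases ha with ha | ha <;> linarith
  rw [FE_apply hd hν]
  rcases le_or_gt (1/2) (x + r) with h | h
  · left
    rw [Finset.sum_eq_zero, mul_zero, add_zero]
    intro a ha
    apply hz
    right
    have h1 : (a:ℝ) * s ≤ 1 / 8 := by
      refine le_trans ?_ hts
      gcongr
      exact (Finset.mem_range.1 ha).le
    linarith
  · right
    have h0 : σ (Set.Icc (x - r) (x + r)) = 0 := by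
      refine measure_mono_null ?_ hσ
      rintro y ⟨hy1, hy2⟩ ⟨hy3, hy4⟩
      linarith
    rw [h0, zero_add]
    by_cases hex : ∃ a : ℕ, a < t ∧ ¬ (x + r < a * s ∨ a * s + d < x - r)
    · obtain ⟨a, ha, hna⟩ := hex
      push Not at hna
      refine ⟨(x - a * s) / d, ?_⟩
      rw [Finset.sum_eq_single_of_mem a (Finset.mem_range.2 ha), aff_preimage_Icc hd]
      intro b _ hb
      apply hz
      rcases lt_or_gt_of_ne hb with hlt | hgt
      · right
        have : (b:ℝ) + 1 ≤ a := by exact_mod_cast hlt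
        nlinarith
      · left
        have : (a:ℝ) + 1 ≤ b := by exact_mod_cast hgt
        nlinarith
    · push Not at hex
      refine ⟨0, ?_⟩
      rw [Finset.sum_eq_zero, mul_zero]
      · exact zero_le
      · intro a ha
        apply hz
        by_contra hcon
        push Not at hcon
        have := hex a (Finset.mem_range.1 ha) 
        grind

lemma FE_upper [IsFiniteMeasure ν] (hd : 0 < d) (hd1 : d < 1) (hα : 0 < α) (hν : ν = σ + SS d α s t ν)
    (hs : 0 < s) (hts : t * s ≤ 1 / 8) (hds : d ≤ s / 8) (hs8 : s ≤ 1 / 8)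
    (hσ : σ (Set.Icc (1/2) (3/4))ᶜ = 0) (hsupp : ν (Set.Icc 0 1)ᶜ = 0) {C : ℝ} (hC : 0 < C)
    (hup : UpReg σ α C) : UpReg ν α (max C ((ν Set.univ).toReal * (s / 4) ^ (-α))) := by
  set M := max C ((ν Set.univ).toReal * (s / 4) ^ (-α)) with hM
  have hM0 : 0 < M := lt_max_of_lt_left hC
  have hmain : ∀ n : ℕ, ∀ x r, 0 < r → s / 4 * d ^ n ≤ r → ν (Set.Icc (x - r) (x + r)) ≤ ENNReal.ofReal (M * r ^ α) := by
    intro n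
    induction n with
    | zero =>
      intro x r hr hsr
      rw [pow_zero, mul_one] at hsr
      refine (measure_mono (Set.subset_univ _)).trans ?_
      rw [← ENNReal.ofReal_toReal (measure_ne_top ν Set.univ)]
      apply ENNReal.ofReal_le_ofReal
      calc (ν Set.univ).toReal = (ν Set.univ).toReal * (s / 4) ^ (-α) * (s/4) ^ α := by
            rw [mul_assoc, ← Real.rpow_add (by positivity)]; simp
        _ ≤ M * r ^ α := by
            gcongr
            exact le_max_right _ _
    | succ n ih =>
      intro x r hr hsr
      rcases le_or_gt (s / 4) r with h | h
      · refine (measure_mono (Set.subset_univ _)).trans ?_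
        rw [← ENNReal.ofReal_toReal (measure_ne_top ν Set.univ)]
        apply ENNReal.ofReal_le_ofReal
        calc (ν Set.univ).toReal = (ν Set.univ).toReal * (s / 4) ^ (-α) * (s/4) ^ α := by
              rw [mul_assoc, ← Real.rpow_add (by positivity)]; simp
          _ ≤ M * r ^ α := by
              gcongr
              exact le_max_right _ _
      · rcases FE_one_piece hd hν hs hts hds hs8 hσ hsupp x r h with h1 | ⟨y, h1⟩
        · refine h1.trans ((hup x r hr).trans (ENNReal.ofReal_le_ofReal ?_))
          gcongr
          exact le_max_left _ _
        · refine h1.trans ?_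
          have h2 := ih y (r / d) (by positivity) (by rw [le_div_iff₀ hd, mul_assoc, ← pow_succ]; exact hsr)
          refine (mul_le_mul_right h2 _).trans ?_
          rw [← ENNReal.ofReal_mul (by positivity)]
          apply ENNReal.ofReal_le_ofReal
          rw [Real.div_rpow hr.le hd.le]
          have : 0 < d ^ α := by positivity
          apply le_of_eq; field_simp
  intro x r hr
  obtain ⟨n, hn⟩ := exists_pow_lt_of_lt_one (show 0 < r / (s / 4) by positivity) hd1
  rw [lt_div_iff₀ (by positivity)] at hn
  exact hmain n x r hr (by linarith)

lemma norm_fhat_le (m : Measure ℝ) [IsFiniteMeasure m] (ξ : ℝ) : ‖fhat m ξ‖ ≤ (m Set.univ).toReal := by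
  have := norm_integral_le_of_norm_le_const (μ := m) (f := ee ξ) (C := 1)
    (Eventually.of_forall fun x => by simp)
  rw [one_mul] at this
  exact this

lemma integrable_ee (m : Measure ℝ) [IsFiniteMeasure m] (ξ : ℝ) : Integrable (ee ξ) m :=
  Integrable.of_bound (C := 1) (continuous_ee ξ).aestronglyMeasurable (Eventually.of_forall fun x => by simp)

lemma fhat_add (m n : Measure ℝ) [IsFiniteMeasure m] [IsFiniteMeasure n] (ξ : ℝ) :
    fhat (m + n) ξ = fhat m ξ + fhat n ξ :=
  integral_add_measure (integrable_ee m ξ) (integrable_ee n ξ)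

lemma fhat_SS [IsFiniteMeasure ν] (hd : 0 < d) (ξ : ℝ) :
    ‖fhat (SS d α s t ν) ξ‖ ≤ t * d ^ α * ‖fhat ν (d * ξ)‖ := by
  unfold SS
  rw [fhat, integral_smul_measure, integral_finsetSum_measure]
  · rw [ENNReal.toReal_ofReal (by positivity), norm_smul, Real.norm_of_nonneg (by positivity), mul_comm (t:ℝ), mul_assoc]
    gcongr
    refine (norm_sum_le _ _).trans ?_
    have : ∀ a ∈ Finset.range t, ‖∫ x, ee ξ x ∂(ν.map fun x => d * x + (a:ℝ) * s)‖ = ‖fhat ν (d * ξ)‖ := by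
      intro a _
      have := fhat_aff hd (a * s) ξ ν
      rw [fhat] at this
      rw [this, norm_mul, norm_ee, mul_one]
    rw [Finset.sum_congr rfl this]
    simp
  · intro a _
    have : IsFiniteMeasure (ν.map fun x => d * x + (a:ℝ) * s) := inferInstance
    exact integrable_ee _ ξ

lemma FE_fhat [IsFiniteMeasure ν] [IsFiniteMeasure σ] (hd : 0 < d) (hν : ν = σ + SS d α s t ν) (ξ : ℝ) :
    ‖fhat ν ξ‖ ≤ ‖fhat σ ξ‖ + t * d ^ α * ‖fhat ν (d * ξ)‖ := by
  have hfin : IsFiniteMeasure (SS d α s t ν) := by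
    unfold SS
    constructor
    rw [Measure.smul_apply]
    exact ENNReal.mul_lt_top ENNReal.ofReal_lt_top (measure_lt_top _ _)
  calc ‖fhat ν ξ‖ = ‖fhat σ ξ + fhat (SS d α s t ν) ξ‖ := by rw [← fhat_add, ← hν]
    _ ≤ _ := (norm_add_le _ _).trans (by gcongr; exact fhat_SS hd ξ)

lemma FE_decay [IsFiniteMeasure ν] [IsFiniteMeasure σ] (hd : 0 < d) (hd1 : d < 1) (hν : ν = σ + SS d α s t ν)
    {τ τ' : ℝ} (hτ0 : 0 < τ) (hτ : τ < τ') (hθ : t * d ^ α = d ^ τ) {C : ℝ} (hC : 0 < C) (hdec : Dec σ τ' C) :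
    ∃ C' : ℝ, 0 < C' ∧ Dec ν τ C' := by
  set V := (ν Set.univ).toReal with hV
  have hV0 : 0 ≤ V := ENNReal.toReal_nonneg
  have hκ : 1 < d ^ (τ - τ') := Real.one_lt_rpow_of_pos_of_lt_one_of_neg hd hd1 (by linarith)
  set K := C / (d ^ (τ - τ') - 1) with hK
  have hK0 : 0 < K := div_pos hC (by linarith)
  have hKe : K * d ^ (τ - τ') = K + C := by
    have : d ^ (τ - τ') - 1 ≠ 0 := by linarith
    rw [hK]; field_simp; ring
  set C' := V + K * d ^ (-τ') with hC'
  have hC'0 : 0 < C' := by positivity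
  have hbase : ∀ ξ : ℝ, d ≤ |ξ| → |ξ| ≤ 1 → ‖fhat ν ξ‖ ≤ C' * |ξ| ^ (-τ) - K * |ξ| ^ (-τ') := by
    intro ξ h1 h2
    have hξ : 0 < |ξ| := hd.trans_le h1
    have h3 : 1 ≤ |ξ| ^ (-τ) := Real.one_le_rpow_of_pos_of_le_one_of_nonpos hξ h2 (by linarith)
    have h4 : |ξ| ^ (-τ') ≤ d ^ (-τ') := Real.rpow_le_rpow_of_nonpos hd h1 (by linarith)
    have h5 := norm_fhat_le ν ξ
    have h6 : K * |ξ| ^ (-τ') ≤ K * d ^ (-τ') := by gcongr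
    have h7 : C' * 1 ≤ C' * |ξ| ^ (-τ) := by gcongr
    linarith
  have hmain : ∀ n : ℕ, ∀ ξ : ℝ, d ≤ |ξ| → |ξ| * d ^ n ≤ 1 → ‖fhat ν ξ‖ ≤ C' * |ξ| ^ (-τ) - K * |ξ| ^ (-τ') := by
    intro n
    induction n with
    | zero => intro ξ h1 h2; exact hbase ξ h1 (by simpa using h2)
    | succ n ih =>
      intro ξ h1 h2
      rcases le_or_gt |ξ| 1 with h | h
      · exact hbase ξ h1 h
      · have hξ : 0 < |ξ| := by linarith
        have habs : |d * ξ| = d * |ξ| := by rw [abs_mul, abs_of_pos hd]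
        have h3 := ih (d * ξ) (by rw [habs]; nlinarith) (by rw [habs]; rw [pow_succ] at h2; linarith)
        have h4 := FE_fhat hd hν ξ
        have h5 := hdec ξ (abs_pos.1 hξ)
        rw [hθ] at h4
        have h6 : 0 < d ^ τ := by positivity
        have h7 := mul_le_mul_of_nonneg_left h3 h6.le
        rw [habs, Real.mul_rpow hd.le hξ.le, Real.mul_rpow hd.le hξ.le] at h7
        have e1 : d ^ τ * (C' * (d ^ (-τ) * |ξ| ^ (-τ)) - K * (d ^ (-τ') * |ξ| ^ (-τ')))
          = C' * |ξ| ^ (-τ) - (K + C) * |ξ| ^ (-τ') := by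
          have a1 : d ^ τ * d ^ (-τ) = 1 := by rw [← Real.rpow_add hd]; simp
          have a2 : d ^ τ * d ^ (-τ') = d ^ (τ - τ') := by rw [← Real.rpow_add hd]; rfl
          calc _ = C' * (d ^ τ * d ^ (-τ)) * |ξ| ^ (-τ) - K * (d ^ τ * d ^ (-τ')) * |ξ| ^ (-τ') := by ring
            _ = _ := by rw [a1, a2, hKe]; ring
        rw [e1] at h7
        linarith
  refine ⟨C', hC'0, fun ξ hξ => ?_⟩
  have hξ0 : 0 < |ξ| := abs_pos.2 hξ
  rcases lt_or_ge |ξ| d with h | h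
  · have h3 : 1 ≤ |ξ| ^ (-τ) := Real.one_le_rpow_of_pos_of_le_one_of_nonpos hξ0 (by linarith) (by linarith)
    have h5 := norm_fhat_le ν ξ
    have h7 : C' * 1 ≤ C' * |ξ| ^ (-τ) := by gcongr
    have : 0 < K * d ^ (-τ') := by positivity
    linarith
  · obtain ⟨n, hn⟩ := exists_pow_lt_of_lt_one (show 0 < 1 / |ξ| by positivity) hd1
    rw [lt_div_iff₀ hξ0] at hn
    have := hmain n ξ h (by linarith)
    have : 0 < K * |ξ| ^ (-τ') := by positivity
    linarith

/-- intervals of generation `l` -/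
noncomputable def PP (d s : ℝ) (t : ℕ) : ℕ → Finset (ℝ × ℝ)
  | 0 => {(0, 1)}
  | l + 1 => Finset.image (fun q : ℕ × (ℝ × ℝ) => (d * q.2.1 + q.1 * s, d * q.2.2 + q.1 * s))
      (Finset.range t ×ˢ PP d s t l)

def AA (d s : ℝ) (t l : ℕ) : Set ℝ := ⋃ p ∈ PP d s t l, Set.Ico p.1 p.2

lemma mem_AA_succ (hd : 0 < d) {l : ℕ} {x : ℝ} :
    x ∈ AA d s t (l+1) ↔ ∃ a, a < t ∧ ∃ y ∈ AA d s t l, x = d * y + a * s := by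
  simp only [AA, PP, Set.mem_iUnion, Finset.mem_image, Finset.mem_product, Finset.mem_range, Set.mem_Ico]
  constructor
  · rintro ⟨p, ⟨⟨a, q⟩, ⟨ha, hq⟩, rfl⟩, h1, h2⟩
    simp only at h1 h2 ha hq
    refine ⟨a, ha, (x - a * s) / d, ⟨q, hq, ?_, ?_⟩, ?_⟩
    · rw [le_div_iff₀ hd]; linarith
    · rw [div_lt_iff₀ hd]; linarith
    · field_simp; ring
  · rintro ⟨a, ha, y, ⟨q, hq, h1, h2⟩, rfl⟩
    refine ⟨_, ⟨(a, q), ⟨ha, hq⟩, rfl⟩, ?_, ?_⟩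
    · simp only; gcongr
    · simp only; gcongr

lemma AA_zero : AA d s t 0 = Set.Ico 0 1 := by simp [AA, PP]

lemma FE_AA (hd : 0 < d) (hν : ν = σ + SS d α s t ν) [IsProbabilityMeasure σ]
    (hσ : σ (Set.Icc (1/2) (3/4))ᶜ = 0) (l : ℕ) :
    ENNReal.ofReal ((t * d ^ α) ^ l) ≤ ν (AA d s t l) := by
  induction l with
  | zero =>
    rw [AA_zero, FE_apply hd hν]
    refine le_trans ?_ le_self_add
    have : σ (Set.Ico 0 1) = 1 := by
      rw [← measure_univ (μ := σ)]
      refine measure_congr (eventuallyEq_univ.2 ?_)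
      rw [mem_ae_iff]
      refine measure_mono_null (Set.compl_subset_compl.2 fun x hx => ?_) hσ
      exact ⟨by linarith [hx.1], by linarith [hx.2]⟩
    rw [this]; simp
  | succ l ih =>
    rw [FE_apply hd hν]
    refine le_trans ?_ le_add_self
    have h1 : ∑ a ∈ Finset.range t, ν (AA d s t l) ≤
        ∑ a ∈ Finset.range t, ν ((fun x => d * x + a * s) ⁻¹' AA d s t (l+1)) :=
      Finset.sum_le_sum fun a ha => measure_mono fun y hy =>
        (mem_AA_succ hd).2 ⟨a, Finset.mem_range.1 ha, y, hy, rfl⟩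
    refine le_trans ?_ (mul_le_mul_right h1 _)
    rw [Finset.sum_const, Finset.card_range, nsmul_eq_mul]
    refine le_trans ?_ (mul_le_mul_right (mul_le_mul_right ih _) _)
    rw [← ENNReal.ofReal_natCast, ← ENNReal.ofReal_mul (by positivity), ← ENNReal.ofReal_mul (by positivity)]
    apply ENNReal.ofReal_le_ofReal
    rw [pow_succ]; apply le_of_eq; ring

end piece

/-- contraction ratio -/
noncomputable def dd (α β : ℝ) (t : ℕ) : ℝ := (t:ℝ) ^ (-(1 / (α - β / 2)))
/-- spacing -/
noncomputable def sg (t : ℕ) : ℝ := 1 / (8 * t)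

lemma dd_theta {α β : ℝ} (hβ0 : 0 < β) (hβα : β < α) {t : ℕ} (ht : 1 ≤ t) :
    t * dd α β t ^ α = dd α β t ^ (β / 2) := by
  have ht0 : (0:ℝ) < t := by exact_mod_cast ht
  unfold dd
  have hg : α - β / 2 ≠ 0 := by linarith
  rw [← Real.rpow_mul ht0.le, ← Real.rpow_mul ht0.le]
  nth_rewrite 1 [← Real.rpow_one (t:ℝ)]
  rw [← Real.rpow_add ht0]
  congr 1
  have hg1 : 1 / (α - β / 2) * (α - β / 2) = 1 := one_div_mul_cancel hg
  linear_combination -hg1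

lemma dd_small {α β : ℝ} (hβ0 : 0 < β) (hβα : β < α) (hα1 : α < 1) :
    ∃ t₀ : ℕ, 1 ≤ t₀ ∧ ∀ t : ℕ, t₀ ≤ t → 0 < dd α β t ∧ dd α β t < 1 ∧ dd α β t ≤ sg t / 8 := by
  have hg0 : 0 < α - β / 2 := by linarith
  have hp : 0 < 1 / (α - β / 2) - 1 := by
    rw [sub_pos, lt_div_iff₀ hg0]; linarith
  have h1 := (tendsto_rpow_atTop hp).comp tendsto_natCast_atTop_atTop
  obtain ⟨N, hN⟩ := (h1.eventually_ge_atTop 64).exists_forall_of_atTop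
  refine ⟨max N 1, le_max_right _ _, fun t ht => ?_⟩
  have ht1 : 1 ≤ t := (le_max_right _ _).trans ht
  have ht0 : (0:ℝ) < t := by exact_mod_cast ht1
  have h2 := hN t ((le_max_left _ _).trans ht)
  simp only [Function.comp] at h2
  have hd0 : 0 < dd α β t := Real.rpow_pos_of_pos ht0 _
  have h3 : dd α β t * (t * (t:ℝ) ^ (1 / (α - β / 2) - 1)) = 1 := by
    unfold dd
    nth_rewrite 2 [← Real.rpow_one (t:ℝ)]
    rw [← Real.rpow_add ht0, ← Real.rpow_add ht0]
    ring_nf; simp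
  have h4 : dd α β t ≤ sg t / 8 := by
    unfold sg
    rw [div_div, le_div_iff₀ (by positivity)]
    have : dd α β t * (t * 64) ≤ dd α β t * (t * (t:ℝ) ^ (1 / (α - β / 2) - 1)) := by gcongr
    linarith
  refine ⟨hd0, ?_, h4⟩
  have : sg t / 8 < 1 := by
    unfold sg
    rw [div_div, div_lt_one (by positivity)]
    have : (1:ℝ) ≤ t := by exact_mod_cast ht1
    linarith
  linarith

structure Piece (α β : ℝ) (t : ℕ) (ν : Measure ℝ) (c C : ℝ) : Prop where
  fin : IsFiniteMeasure ν
  c0 : 0 < c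
  C0 : 0 < C
  supp : ν (Set.Icc 0 1)ᶜ = 0
  up : UpReg ν α C
  lo : LoReg ν α c
  dec : Dec ν (β / 2) C
  mass : ν Set.univ ≤ ENNReal.ofReal C
  AA : ∀ l, ENNReal.ofReal ((dd α β t ^ (β / 2)) ^ l) ≤ ν (AA (dd α β t) (sg t) t l)

lemma exists_piece {α β : ℝ} (hβ0 : 0 < β) (hβα : β < α) (hα1 : α < 1) :
    ∃ t₀ : ℕ, 1 ≤ t₀ ∧ ∀ t : ℕ, t₀ ≤ t → 
      (0 < dd α β t ∧ dd α β t < 1 ∧ dd α β t ≤ sg t / 8) ∧ ∃ ν c C, Piece α β t ν c C := by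
  obtain ⟨t₀, ht₀, h⟩ := dd_small hβ0 hβα hα1
  refine ⟨t₀, ht₀, fun t ht => ⟨h t ht, ?_⟩⟩
  obtain ⟨hd, hd1, hds⟩ := h t ht
  have ht1 : 1 ≤ t := ht₀.trans ht
  have ht1' : (1:ℝ) ≤ t := by exact_mod_cast ht1
  have hα0 : 0 < α := by linarith
  obtain ⟨σ, c, C, hσp, hc, hC, hσs, hup, hlo, hdec⟩ :=
    base_measure (τ := (α + β) / 4) hα0 hα1 (by linarith) (by linarith)
  set σ' := σ.map (fun y : ℝ => (1/4) * y + 1/2) with hσ'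
  have hup' := hup.map (d := 1/4) (by norm_num) (1/2)
  have hlo' := hlo.map (d := 1/4) (by norm_num) (by norm_num) (1/2)
  have hdec' := hdec.map (d := 1/4) (by norm_num) (1/2)
  have hσp' : IsProbabilityMeasure σ' :=
    Measure.isProbabilityMeasure_map (aff_emb (by norm_num) _).measurable.aemeasurable
  have hσs' : σ' (Set.Icc (1/2) (3/4))ᶜ = 0 := by
    rw [hσ', (aff_emb (by norm_num) _).map_apply]
    refine measure_mono_null ?_ hσs
    intro y hy hy2
    apply hy
    constructor <;> simp only <;> linarith [hy2.1, hy2.2]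
  have hsg : 0 < sg t := by unfold sg; positivity
  have hts : t * sg t ≤ 1 / 8 := by unfold sg; apply le_of_eq; field_simp
  have hs8 : sg t ≤ 1 / 8 := by nlinarith
  have hth := dd_theta hβ0 hβα ht1
  have hθ : t * dd α β t ^ α < 1 := by rw [hth]; exact Real.rpow_lt_one hd.le hd1 (by linarith)
  obtain ⟨ν, hfin, hν⟩ := exists_fixed hd α (sg t) t σ' hθ
  have hsupp := FE_support hd hν hθ hsg hts hds ht1 hσs'
  have u := FE_upper hd hd1 hα0 hν hsg hts hds hs8 hσs' hsupp (by positivity) hup'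
  have lo := FE_lower hd hα0 hν hθ hsupp hc hlo'
  obtain ⟨C', hC', hdec''⟩ := FE_decay (τ := β / 2) hd hd1 hν (by linarith) (by linarith) hth (by positivity) hdec'
  set C1 := max (C * (1/4) ^ (-α)) ((ν Set.univ).toReal * (sg t / 4) ^ (-α)) with hC1
  have hC10 : 0 < C1 := lt_max_of_lt_left (by positivity)
  have hV0 : 0 ≤ (ν Set.univ).toReal := ENNReal.toReal_nonneg
  refine ⟨ν, _, C1 + C' + (ν Set.univ).toReal, ⟨hfin, ?_, by positivity, hsupp, ?_, lo, ?_, ?_, ?_⟩⟩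
  · exact lt_min hc (by positivity)
  · intro x r hr
    refine (u x r hr).trans (ENNReal.ofReal_le_ofReal ?_)
    gcongr
    linarith
  · intro ξ hξ
    refine (hdec'' ξ hξ).trans ?_
    gcongr
    linarith
  · rw [← ENNReal.ofReal_toReal (measure_ne_top ν Set.univ)]
    apply ENNReal.ofReal_le_ofReal
    rw [ENNReal.ofReal_toReal (measure_ne_top ν Set.univ)]
    linarith
  · intro l
    rw [← hth]
    exact FE_AA hd hν hσs' l

end ChenSharp

namespace ChenSharp

structure Test (w h : ℝ → ℝ) (S : ℝ) : Prop where
  S0 : 0 < S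
  meas : Measurable w
  nonneg : ∀ ξ, 0 ≤ w ξ
  int : Integrable w
  bd : ∀ ξ, w ξ ≤ S
  four : ∀ x, (h x : ℂ) = ∫ ξ, (w ξ : ℂ) * ee ξ x
  hcont : Continuous h
  hnn : ∀ x, 0 ≤ h x
  supp : ∀ x, 2 < |x| → h x = 0
  h0 : h 0 = 1

noncomputable def tri (x : ℝ) : ℝ := max 0 (1 - |x| / 2)

lemma tri_cont : Continuous tri := by unfold tri; fun_prop

noncomputable def fej (ξ : ℝ) : ℝ := (1 - Real.cos (2 * (2 * Real.pi * ξ))) / (2 * Real.pi * ξ) ^ 2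

lemma tri_zero {x : ℝ} (hx : 2 ≤ |x|) : tri x = 0 := by
  unfold tri; exact max_eq_left (by linarith)

lemma tri_pos {x : ℝ} (hx0 : 0 ≤ x) (hx : x ≤ 2) : tri x = 1 - x / 2 := by
  unfold tri; rw [abs_of_nonneg hx0]; exact max_eq_right (by linarith)

lemma tri_neg (x : ℝ) : tri (-x) = tri x := by unfold tri; rw [abs_neg]

lemma ee_add_neg (ξ x : ℝ) : ee ξ (-x) + ee ξ x = ((2 * Real.cos (2 * Real.pi * ξ * x) : ℝ) : ℂ) := by
  rw [ee_eq, ee_eq]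
  push_cast
  rw [Complex.two_cos]
  congr 2 <;> ring

lemma tri_integral {k : ℝ} (hk : k ≠ 0) :
    ∫ x in (0:ℝ)..2, (1 - x / 2) * (2 * Real.cos (k * x)) = (1 - Real.cos (2 * k)) / k ^ 2 := by
  have hder : ∀ x : ℝ, HasDerivAt (fun x => (1 - x / 2) * (2 * Real.sin (k * x) / k) - Real.cos (k * x) / k ^ 2)
      ((1 - x / 2) * (2 * Real.cos (k * x))) x := by
    intro x
    have h1 : HasDerivAt (fun x : ℝ => k * x) k x := by simpa using (hasDerivAt_id x).const_mul k
    have h2 := h1.sin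
    have h3 := h1.cos
    have h4 : HasDerivAt (fun x : ℝ => 1 - x / 2) (-(1/2)) x := by
      simpa using ((hasDerivAt_id x).div_const 2).const_sub 1
    have h5 := (h4.mul ((h2.const_mul 2).div_const k)).sub (h3.div_const (k^2))
    refine HasDerivAt.congr_deriv h5 ?_
    field_simp
    ring
  rw [intervalIntegral.integral_eq_sub_of_hasDerivAt (fun x _ => hder x)]
  · simp; ring_nf
  · apply Continuous.intervalIntegrable; fun_prop

lemma tri_fourier {ξ : ℝ} (hξ : ξ ≠ 0) :
    ∫ x, ee ξ x * (tri x : ℂ) = (fej ξ : ℂ) := by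
  have hc : Continuous fun x => ee ξ x * (tri x : ℂ) :=
    (continuous_ee ξ).mul (Complex.continuous_ofReal.comp tri_cont)
  have h1 : ∫ x, ee ξ x * (tri x : ℂ) = ∫ x in (-2:ℝ)..2, ee ξ x * (tri x : ℂ) := by
    rw [intervalIntegral.integral_of_le (by norm_num)]
    symm
    apply setIntegral_eq_integral_of_forall_compl_eq_zero
    intro x hx
    rw [Set.mem_Ioc, not_and_or, not_lt, not_le] at hx
    have : 2 ≤ |x| := by
      rcases hx with hx | hx
      · rw [le_abs]; right; linarith
      · rw [le_abs]; left; linarith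
    rw [tri_zero this]; simp
  rw [h1, ← intervalIntegral.integral_add_adjacent_intervals (b := 0) (hc.intervalIntegrable _ _) (hc.intervalIntegrable _ _)]
  have h2 : ∫ x in (-2:ℝ)..0, ee ξ x * (tri x : ℂ) = ∫ x in (0:ℝ)..2, ee ξ (-x) * (tri (-x) : ℂ) := by
    have := intervalIntegral.integral_comp_neg (a := 0) (b := 2) (fun x => ee ξ x * (tri x : ℂ))
    rw [this]; simp
  have hc' : Continuous fun x => ee ξ (-x) * (tri (-x) : ℂ) := hc.comp continuous_neg
  rw [h2, ← intervalIntegral.integral_add (hc'.intervalIntegrable _ _) (hc.intervalIntegrable _ _)]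
  have hk : 2 * Real.pi * ξ ≠ 0 := by have := Real.pi_pos; positivity
  unfold fej
  rw [← tri_integral hk, ← intervalIntegral.integral_ofReal]
  apply intervalIntegral.integral_congr
  intro x hx
  rw [Set.uIcc_of_le (by norm_num)] at hx
  simp only
  rw [tri_neg, ← add_mul, ee_add_neg, tri_pos hx.1 hx.2]
  push_cast; ring

lemma fej_nonneg (ξ : ℝ) : 0 ≤ fej ξ := by
  unfold fej
  have := Real.cos_le_one (2 * (2 * Real.pi * ξ))
  apply div_nonneg (by linarith) (by positivity)

lemma fej_le (ξ : ℝ) : fej ξ ≤ 3 * (1 + ξ ^ 2)⁻¹ := by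
  unfold fej
  rcases eq_or_ne ξ 0 with rfl | hξ
  · simp
  have hpi := Real.pi_gt_three
  set k := 2 * Real.pi * ξ with hk
  have hk2 : 36 * ξ ^ 2 ≤ k ^ 2 := by
    rw [hk, mul_pow]; gcongr; nlinarith
  have hk0 : 0 < k ^ 2 := by rw [hk]; positivity
  have h1 : 1 - Real.cos (2 * k) ≤ 2 := by linarith [Real.neg_one_le_cos (2 * k)]
  have h2 : 1 - Real.cos (2 * k) ≤ 2 * k ^ 2 := by
    have := Real.one_sub_sq_div_two_le_cos (x := 2 * k)
    nlinarith
  rw [← div_eq_mul_inv, div_le_div_iff₀ hk0 (by positivity)]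
  have h3 : ξ ^ 2 * (1 - Real.cos (2 * k)) ≤ ξ ^ 2 * 2 := by gcongr
  linarith

lemma fej_meas : Measurable fej := by unfold fej; fun_prop

lemma fej_int : Integrable fej := by
  refine (integrable_inv_one_add_sq.const_mul 3).mono' fej_meas.aestronglyMeasurable ?_
  exact Eventually.of_forall fun ξ => by
    rw [Real.norm_of_nonneg (fej_nonneg ξ)]; exact fej_le ξ

open FourierTransform in
lemma test_base : Test fej tri 3 where
  S0 := by norm_num
  meas := fej_meas
  nonneg := fej_nonneg
  int := fej_int
  bd := fun ξ => (fej_le ξ).trans (by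
    have : (1 + ξ ^ 2)⁻¹ ≤ 1 := inv_le_one_of_one_le₀ (by nlinarith [sq_nonneg ξ])
    linarith)
  four := by
    have hc : Continuous fun x => (tri x : ℂ) := Complex.continuous_ofReal.comp tri_cont
    have hF : ∀ ξ, (𝓕 (fun x => (tri x : ℂ))) ξ = ∫ x, ee ξ x * (tri x : ℂ) := by
      intro ξ
      rw [Real.fourier_real_eq_integral_exp_smul]
      congr 1; ext x
      rw [ee_eq, smul_eq_mul]
      congr 3
      push_cast; ring
    have hae : (𝓕 (fun x => (tri x : ℂ))) =ᵐ[volume] fun ξ => (fej ξ : ℂ) := by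
      have : ∀ᵐ ξ : ℝ, ξ ≠ 0 := by
        rw [ae_iff]; simp
      filter_upwards [this] with ξ hξ
      rw [hF, tri_fourier hξ]
    have hi : Integrable fun x => (tri x : ℂ) := by
      apply hc.integrable_of_hasCompactSupport
      refine HasCompactSupport.intro (K := Set.Icc (-2) 2) isCompact_Icc fun x hx => ?_
      rw [Set.mem_Icc, not_and_or, not_le, not_le] at hx
      have : 2 ≤ |x| := by
        rcases hx with hx | hx
        · rw [le_abs]; right; linarith
        · rw [le_abs]; left; linarith
      rw [tri_zero this]; simp
    have hi2 : Integrable (𝓕 (fun x => (tri x : ℂ))) := (fej_int.ofReal).congr hae.symm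
    have hinv := hc.fourierInv_fourier_eq hi hi2
    intro x
    have h1 := congrFun hinv (-x)
    simp only [tri_neg] at h1
    rw [← h1, Real.fourierInv_eq']
    apply integral_congr_ae
    filter_upwards [hae] with ξ hξ
    rw [hξ, smul_eq_mul, mul_comm, ee_eq]
    congr 3
    simp
    ring
  hcont := tri_cont
  hnn := fun x => le_max_left _ _
  supp := fun x hx => tri_zero hx.le
  h0 := by simp [tri]

lemma Test.integral_w {w h : ℝ → ℝ} {S : ℝ} (T : Test w h S) : ∫ ξ, w ξ = 1 := by
  have := T.four 0
  simp only [ee_zero, mul_one, T.h0] at this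
  rw [integral_complex_ofReal] at this
  exact_mod_cast this.symm

lemma Test.h_le {w h : ℝ → ℝ} {S : ℝ} (T : Test w h S) (x : ℝ) : h x ≤ 1 := by
  have h1 : ‖(h x : ℂ)‖ ≤ ∫ ξ, w ξ := by
    rw [T.four x]
    refine (norm_integral_le_integral_norm _).trans (le_of_eq ?_)
    congr 1; ext ξ
    rw [norm_mul, norm_ee, mul_one, Complex.norm_real, Real.norm_of_nonneg (T.nonneg ξ)]
  rw [T.integral_w, Complex.norm_real] at h1
  exact (le_abs_self _).trans h1

lemma Test.int_ee {w h : ℝ → ℝ} {S : ℝ} (T : Test w h S) (x : ℝ) :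
    Integrable fun ξ => (w ξ : ℂ) * ee ξ x := by
  refine T.int.mono (((Complex.measurable_ofReal.comp T.meas).mul (continuous_ee' x).measurable).aestronglyMeasurable) ?_
  exact Eventually.of_forall fun ξ => by simp

lemma Test.four_scale {w h : ℝ → ℝ} {S : ℝ} (T : Test w h S) {d : ℝ} (hd : 0 < d) (x : ℝ) :
    Integrable (fun ξ => ((d * w (d * ξ) : ℝ) : ℂ) * ee ξ x) ∧
    ∫ ξ, ((d * w (d * ξ) : ℝ) : ℂ) * ee ξ x = (h (x / d) : ℂ) := by
  have e : (fun ξ => ((d * w (d * ξ) : ℝ) : ℂ) * ee ξ x)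
      = fun ξ => (d:ℂ) * (fun η => (w η : ℂ) * ee η (x / d)) (d * ξ) := by
    ext ξ
    simp only
    rw [← ee_mul_left, mul_div_cancel₀ _ hd.ne']
    push_cast; ring
  rw [e]
  constructor
  · exact ((T.int_ee (x / d)).comp_mul_left' hd.ne').const_mul _
  · rw [integral_const_mul, Measure.integral_comp_mul_left (fun η => (w η : ℂ) * ee η (x / d)) d, ← T.four]
    rw [abs_of_pos (inv_pos.2 hd), Complex.real_smul, Complex.ofReal_inv, ← mul_assoc, mul_inv_cancel₀ (by exact_mod_cast hd.ne'), one_mul]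

lemma Test.scale {w h : ℝ → ℝ} {S : ℝ} (T : Test w h S) {d : ℝ} (hd : 0 < d) (hd1 : d ≤ 1) :
    Test (fun ξ => d * w (d * ξ)) (fun x => h (x / d)) (d * S) where
  S0 := mul_pos hd T.S0
  meas := (T.meas.comp (measurable_const_mul d)).const_mul d
  nonneg := fun ξ => mul_nonneg hd.le (T.nonneg _)
  int := (T.int.comp_mul_left' hd.ne').const_mul d
  bd := fun ξ => by have := T.bd (d * ξ); gcongr
  four := fun x => ((T.four_scale hd x).2).symm
  hcont := T.hcont.comp (continuous_id.div_const d)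
  hnn := fun x => T.hnn _
  supp := fun x hx => T.supp _ (by
    rw [abs_div, abs_of_pos hd, lt_div_iff₀ hd]; nlinarith)
  h0 := by simp [T.h0]

end ChenSharp

namespace ChenSharp

noncomputable def DD (s : ℝ) (N : ℕ) (ξ : ℝ) : ℂ := ∑ b ∈ Finset.range N, ee ξ (b * s)

lemma conj_ee (ξ x : ℝ) : (starRingEnd ℂ) (ee ξ x) = ee ξ (-x) := by
  rw [ee_eq, ee_eq, ← Complex.exp_conj]
  congr 1
  rw [map_mul, Complex.conj_ofReal, Complex.conj_I]
  push_cast; ring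

lemma DD_sq (s : ℝ) (N : ℕ) (ξ : ℝ) : ((‖DD s N ξ‖ ^ 2 : ℝ) : ℂ) =
    ∑ b ∈ Finset.range N, ∑ b' ∈ Finset.range N, ee ξ (((b:ℝ) - b') * s) := by
  push_cast
  rw [← Complex.mul_conj']
  unfold DD
  rw [map_sum, Finset.sum_mul_sum]
  refine Finset.sum_congr rfl fun b _ => Finset.sum_congr rfl fun b' _ => ?_
  rw [conj_ee, ← ee_add]
  congr 1; ring

lemma DD_norm (s : ℝ) (N : ℕ) (ξ : ℝ) : ‖DD s N ξ‖ ≤ N := by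
  unfold DD
  exact (norm_sum_le _ _).trans (by simp)

lemma DD_cont (s : ℝ) (N : ℕ) : Continuous (DD s N) := by
  unfold DD
  exact continuous_finsetSum _ fun b _ => continuous_ee' _

noncomputable def stepw (d s : ℝ) (N : ℕ) (w : ℝ → ℝ) (ξ : ℝ) : ℝ :=
  d * w (d * ξ) * ((1 / N) * ‖DD s N ξ‖ ^ 2)

noncomputable def steph (d s : ℝ) (N : ℕ) (h : ℝ → ℝ) (x : ℝ) : ℝ :=
  (1 / N) * ∑ b ∈ Finset.range N, ∑ b' ∈ Finset.range N, h ((x + ((b:ℝ) - b') * s) / d)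

lemma DD_sq_le (s : ℝ) {N : ℕ} (hN : 1 ≤ N) (ξ : ℝ) : (1 / (N:ℝ)) * ‖DD s N ξ‖ ^ 2 ≤ (N:ℝ) := by
  have hN0 : (0:ℝ) < N := by exact_mod_cast hN
  calc (1 / (N:ℝ)) * ‖DD s N ξ‖ ^ 2 ≤ (1 / (N:ℝ)) * (N:ℝ) ^ 2 := by
        gcongr; exact DD_norm s N ξ
    _ = (N:ℝ) := by field_simp

lemma Test.step {w h : ℝ → ℝ} {S : ℝ} (T : Test w h S) {d s : ℝ} (hd : 0 < d) (hs : 0 < s) {N : ℕ} (hN : 1 ≤ N)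
    (hNs : N * s ≤ 1 / 4) (hds : d ≤ s / 8) (hs8 : s ≤ 1 / 8) :
    Test (stepw d s N w) (steph d s N h) (N * d * S) where
  S0 := by have := T.S0; have : (0:ℝ) < N := by exact_mod_cast hN
           positivity
  meas := ((T.meas.comp (measurable_const_mul d)).const_mul d).mul
    (((DD_cont s N).norm.pow 2).measurable.const_mul _)
  nonneg := fun ξ => mul_nonneg (mul_nonneg hd.le (T.nonneg _)) (by positivity)
  int := by
    refine (((T.int.comp_mul_left' hd.ne').const_mul d).mul_const (N:ℝ)).mono' 
      (((T.meas.comp (measurable_const_mul d)).const_mul d).mul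
        (((DD_cont s N).norm.pow 2).measurable.const_mul _)).aestronglyMeasurable ?_
    refine Eventually.of_forall fun ξ => ?_
    unfold stepw
    rw [Real.norm_of_nonneg (mul_nonneg (mul_nonneg hd.le (T.nonneg _)) (by positivity))]
    exact mul_le_mul_of_nonneg_left (DD_sq_le s hN ξ) (mul_nonneg hd.le (T.nonneg _))
  bd := fun ξ => by
    unfold stepw
    calc _ ≤ d * S * N := mul_le_mul (mul_le_mul_of_nonneg_left (T.bd _) hd.le) (DD_sq_le s hN ξ)
          (by positivity) (mul_nonneg hd.le T.S0.le)
      _ = _ := by ring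
  four := fun x => by
    have e : ∀ ξ, (stepw d s N w ξ : ℂ) * ee ξ x = (1 / N : ℂ) * ∑ b ∈ Finset.range N, ∑ b' ∈ Finset.range N,
        ((d * w (d * ξ) : ℝ) : ℂ) * ee ξ (x + ((b:ℝ) - b') * s) := by
      intro ξ
      unfold stepw
      rw [Complex.ofReal_mul, Complex.ofReal_mul (1 / (N:ℝ)), DD_sq]
      simp only [ee_add]
      simp only [← mul_assoc, ← Finset.mul_sum]
      push_cast
      ring
    simp only [e]
    rw [integral_const_mul, integral_finsetSum]
    · unfold steph
      rw [Complex.ofReal_mul, Complex.ofReal_sum]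
      congr 1
      · push_cast; rfl
      refine Finset.sum_congr rfl fun b _ => ?_
      rw [integral_finsetSum, Complex.ofReal_sum]
      · refine Finset.sum_congr rfl fun b' _ => ?_
        rw [(T.four_scale hd _).2]
      · exact fun b' _ => (T.four_scale hd _).1
    · intro b _
      exact integrable_finsetSum _ fun b' _ => (T.four_scale hd _).1
  hcont := by
    unfold steph
    have := T.hcont
    fun_prop
  hnn := fun x => by
    unfold steph
    exact mul_nonneg (by positivity) (Finset.sum_nonneg fun b _ => Finset.sum_nonneg fun b' _ => T.hnn _)
  supp := fun x hx => by
    unfold steph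
    rw [Finset.sum_eq_zero, mul_zero]
    intro b hb
    apply Finset.sum_eq_zero
    intro b' hb'
    apply T.supp
    have h1 : (b:ℝ) ≤ N := by exact_mod_cast (Finset.mem_range.1 hb).le
    have h2 : (b':ℝ) ≤ N := by exact_mod_cast (Finset.mem_range.1 hb').le
    have h3 : |((b:ℝ) - b') * s| ≤ 1 / 4 := by
      rw [abs_mul, abs_of_pos hs]
      refine le_trans ?_ hNs
      gcongr
      rw [abs_le]
      have : (0:ℝ) ≤ b := by positivity
      have : (0:ℝ) ≤ b' := by positivity
      constructor <;> linarith
    rw [abs_div, abs_of_pos hd, lt_div_iff₀ hd]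
    have h4 := abs_sub_abs_le_abs_sub x (-(((b:ℝ) - b') * s))
    rw [abs_neg, sub_neg_eq_add] at h4
    linarith
  h0 := by
    unfold steph
    have hN0 : (0:ℝ) < N := by exact_mod_cast hN
    have : ∀ b ∈ Finset.range N, ∑ b' ∈ Finset.range N, h ((0 + ((b:ℝ) - b') * s) / d) = 1 := by
      intro b hb
      rw [Finset.sum_eq_single_of_mem b hb]
      · simp [T.h0]
      · intro b' _ hbb
        apply T.supp
        rw [zero_add, abs_div, abs_mul, abs_of_pos hs, abs_of_pos hd, lt_div_iff₀ hd]
        have : (1:ℝ) ≤ |(b:ℝ) - b'| := by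
          have h1 : (b:ℤ) - b' ≠ 0 := by omega
          have := Int.one_le_abs h1
          exact_mod_cast this
        nlinarith
    rw [Finset.sum_congr rfl this]
    simp
    field_simp

lemma steph_lower {w h : ℝ → ℝ} {S : ℝ} (T : Test w h S) {d s : ℝ} (hd : 0 < d) {t : ℕ} (ht : 1 ≤ t)
    {a : ℕ} (ha : a < t) (y : ℝ) : h y / 2 ≤ steph d s (2 * t) h (d * y + a * s) := by
  have ht0 : (0:ℝ) < t := by exact_mod_cast ht
  unfold steph
  have h1 : ∑ b ∈ Finset.range t, h y ≤ ∑ b ∈ Finset.range (2 * t), ∑ b' ∈ Finset.range (2 * t),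
      h ((d * y + a * s + ((b:ℝ) - b') * s) / d) := by
    refine le_trans ?_ (Finset.sum_le_sum_of_subset_of_nonneg
      (Finset.range_mono (by omega : t ≤ 2 * t)) fun b _ _ => Finset.sum_nonneg fun b' _ => T.hnn _)
    refine Finset.sum_le_sum fun b hb => ?_
    rw [Finset.mem_range] at hb
    refine le_trans (le_of_eq ?_) (Finset.single_le_sum
      (f := fun b' : ℕ => h ((d * y + a * s + ((b:ℝ) - b') * s) / d)) (fun b' _ => T.hnn _)
      (Finset.mem_range.2 (by omega : b + a < 2 * t)))
    congr 1
    push_cast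
    field_simp
    ring
  rw [Finset.sum_const, Finset.card_range, nsmul_eq_mul] at h1
  push_cast
  calc h y / 2 = 1 / (2 * t) * (t * h y) := by field_simp
    _ ≤ _ := by gcongr

lemma exists_test {d s : ℝ} {t : ℕ} (hd : 0 < d) (hs : 0 < s) (ht : 1 ≤ t)
    (hts : t * s ≤ 1 / 8) (hds : d ≤ s / 8) (l : ℕ) :
    ∃ w h, Test w h (3 * (2 * t * d) ^ l) ∧ ∀ x ∈ AA d s t l, 1 / 2 * (1 / 2) ^ l ≤ h x := by
  have ht1 : (1:ℝ) ≤ t := by exact_mod_cast ht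
  induction l with
  | zero =>
    refine ⟨fej, tri, by simpa using test_base, fun x hx => ?_⟩
    rw [AA_zero] at hx
    rw [tri_pos hx.1 (by linarith [hx.2])]
    have := hx.2
    simp; linarith
  | succ l ih =>
    obtain ⟨w, h, T, hA⟩ := ih
    refine ⟨stepw d s (2 * t) w, steph d s (2 * t) h, ?_, ?_⟩
    · have := T.step hd hs (N := 2 * t) (by omega) (by push_cast; linarith) hds (by nlinarith)
      convert this using 1
      push_cast; ring
    · intro x hx
      obtain ⟨a, ha, y, hy, rfl⟩ := (mem_AA_succ hd).1 hx
      refine le_trans ?_ (steph_lower T hd ht ha y)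
      have := hA y hy
      rw [pow_succ]; linarith

/-- The main duality bound. -/
lemma Test.bound {w h : ℝ → ℝ} {S : ℝ} (T : Test w h S) (m : Measure ℝ) [IsFiniteMeasure m]
    {F : Set ℝ} (hF : MeasurableSet F) {c : ℝ} (hc : ∀ x ∈ F, c ≤ h x) {q : ℝ} (hq : 2 ≤ q) :
    ENNReal.ofReal (c * (m F).toReal) ≤
      eLpNorm (fun ξ : ℝ => ∫ x in F, ee ξ x ∂m) (ENNReal.ofReal q) volume * ENNReal.ofReal (S ^ (1 / q)) := by
  set g : ℝ → ℂ := fun ξ => ∫ x in F, ee ξ x ∂m with hg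
  have hprod : Integrable (Function.uncurry fun (x ξ : ℝ) => (w ξ : ℂ) * ee ξ x) ((m.restrict F).prod volume) := by
    have hmeas : AEStronglyMeasurable (Function.uncurry fun (x ξ : ℝ) => (w ξ : ℂ) * ee ξ x) ((m.restrict F).prod volume) := by
      apply Measurable.aestronglyMeasurable
      exact ((Complex.measurable_ofReal.comp (T.meas.comp measurable_snd))).mul
        (continuous_ee2.measurable.comp measurable_swap)
    have hw : Integrable (fun p : ℝ × ℝ => (1:ℝ) * w p.2) ((m.restrict F).prod volume) :=
      Integrable.mul_prod (integrable_const (1:ℝ)) T.int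
    refine hw.mono hmeas (Eventually.of_forall fun p => ?_)
    simp [Function.uncurry]
  have h1 : ∫ x in F, (h x : ℂ) ∂m = ∫ ξ, (w ξ : ℂ) * g ξ := by
    simp only [T.four]
    rw [integral_integral_swap hprod]
    simp only [integral_const_mul, hg]
  have h2 : c * (m F).toReal ≤ ∫ x in F, h x ∂m := by
    have hi : IntegrableOn h F m := by
      refine Integrable.of_bound (C := 1) T.hcont.aestronglyMeasurable (Eventually.of_forall fun x => ?_)
      rw [Real.norm_of_nonneg (T.hnn x)]; exact T.h_le x
    have := setIntegral_mono_on (μ := m) (integrable_const c).integrableOn hi hF hc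
    rw [setIntegral_const, smul_eq_mul, mul_comm] at this
    exact this
  have h3 : ENNReal.ofReal (c * (m F).toReal) ≤ ∫⁻ ξ, ‖g ξ‖ₑ * ENNReal.ofReal (w ξ) := by
    calc ENNReal.ofReal (c * (m F).toReal) ≤ ENNReal.ofReal (∫ x in F, h x ∂m) := ENNReal.ofReal_le_ofReal h2
      _ ≤ ‖∫ x in F, (h x : ℂ) ∂m‖ₑ := by
          rw [integral_complex_ofReal, ← ofReal_norm_eq_enorm, Complex.norm_real]
          exact ENNReal.ofReal_le_ofReal (le_abs_self _)
      _ ≤ ∫⁻ ξ, ‖(w ξ : ℂ) * g ξ‖ₑ := by rw [h1]; exact enorm_integral_le_lintegral_enorm _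
      _ = _ := by
          congr 1; ext ξ
          rw [enorm_mul, mul_comm]
          congr 1
          rw [← ofReal_norm_eq_enorm, Complex.norm_real, Real.norm_of_nonneg (T.nonneg ξ)]
  have hgm : AEMeasurable (fun ξ => ‖g ξ‖ₑ) volume := by
    apply Measurable.aemeasurable
    apply Measurable.enorm
    have : StronglyMeasurable (Function.uncurry fun (ξ x : ℝ) => ee ξ x) :=
      (continuous_ee2).stronglyMeasurable
    exact (this.integral_prod_right (ν := m.restrict F)).measurable
  set p := q / (q - 1) with hp
  have hpq : q.HolderConjugate p := Real.HolderConjugate.conjExponent (by linarith)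
  have h4 := ENNReal.lintegral_mul_le_Lp_mul_Lq volume hpq hgm (T.meas.ennreal_ofReal.aemeasurable)
  refine h3.trans (h4.trans ?_)
  have hq0 : 0 < q := by linarith
  have hq1 : 0 < q - 1 := by linarith
  have hp0 : 0 < p := div_pos hq0 hq1
  have hp1 : p - 1 = 1 / (q - 1) := by rw [hp]; field_simp; ring
  have e1 : eLpNorm g (ENNReal.ofReal q) volume = (∫⁻ ξ, ‖g ξ‖ₑ ^ q) ^ (1 / q) := by
    rw [eLpNorm_eq_lintegral_rpow_enorm_toReal (by simpa using hq0) ENNReal.ofReal_ne_top, ENNReal.toReal_ofReal hq0.le]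
  rw [e1]
  refine mul_le_mul_right ?_ _
  have h5 : ∫⁻ ξ, ENNReal.ofReal (w ξ) ^ p ≤ ENNReal.ofReal (S ^ (p - 1)) := by
    have hpt : ∀ ξ, ENNReal.ofReal (w ξ) ^ p ≤ ENNReal.ofReal (S ^ (p - 1)) * ENNReal.ofReal (w ξ) := by
      intro ξ
      rw [ENNReal.ofReal_rpow_of_nonneg (T.nonneg ξ) hp0.le, ← ENNReal.ofReal_mul (by have := T.S0; positivity)]
      apply ENNReal.ofReal_le_ofReal
      rcases (T.nonneg ξ).eq_or_lt with h0 | h0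
      · rw [← h0, Real.zero_rpow hp0.ne']; simp
      · calc w ξ ^ p = w ξ ^ (p - 1) * w ξ := by
              nth_rewrite 3 [← Real.rpow_one (w ξ)]
              rw [← Real.rpow_add h0]; ring_nf
          _ ≤ _ := by
              gcongr
              · rw [hp1]; positivity
              · exact T.bd ξ
    refine (lintegral_mono hpt).trans (le_of_eq ?_)
    rw [lintegral_const_mul _ T.meas.ennreal_ofReal, ← ofReal_integral_eq_lintegral_ofReal T.int (Eventually.of_forall T.nonneg), T.integral_w]
    simp
  refine (ENNReal.rpow_le_rpow h5 (by positivity)).trans (le_of_eq ?_)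
  rw [ENNReal.ofReal_rpow_of_nonneg (by have := T.S0; positivity) (by positivity), ← Real.rpow_mul T.S0.le]
  congr 2
  rw [hp1, hp]; field_simp

end ChenSharp

namespace ChenSharp

structure SP (α β : ℝ) (φ : ℝ → ℝ) (g lam : ℝ) (P : Measure ℝ) : Prop where
  l0 : 0 < lam
  l1 : lam ≤ 1
  supp : P (Set.Icc 0 lam)ᶜ = 0
  up : UpReg P α g
  dec : Dec P (β / 2) g
  mass : P Set.univ ≤ ENNReal.ofReal g
  lo : ∀ᵐ x ∂P, ∀ r, 0 < r → r ≤ 2 * lam →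
    ENNReal.ofReal (1 / 2 * (r ^ α / φ (1 / (4 * r)))) ≤ P (Set.Icc (x - r) (x + r))

lemma UpReg.smul {m : Measure ℝ} {α C W : ℝ} (h : UpReg m α C) (hW : 0 ≤ W) :
    UpReg (ENNReal.ofReal W • m) α (W * C) := by
  intro x r hr
  rw [Measure.smul_apply, smul_eq_mul, mul_assoc, ENNReal.ofReal_mul hW]
  exact mul_le_mul_right (h x r hr) _

lemma fhat_smul (m : Measure ℝ) {W : ℝ} (hW : 0 ≤ W) (ξ : ℝ) :
    fhat (ENNReal.ofReal W • m) ξ = W * fhat m ξ := by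
  unfold fhat
  rw [integral_smul_measure, ENNReal.toReal_ofReal hW, Complex.real_smul]

lemma Dec.smul {m : Measure ℝ} {τ C W : ℝ} (h : Dec m τ C) (hW : 0 ≤ W) :
    Dec (ENNReal.ofReal W • m) τ (W * C) := by
  intro ξ hξ
  rw [fhat_smul m hW, norm_mul, Complex.norm_real, Real.norm_of_nonneg hW, mul_assoc]
  exact mul_le_mul_of_nonneg_left (h ξ hξ) hW

lemma UpReg.mono {m : Measure ℝ} {α C C' : ℝ} (h : UpReg m α C) (hC : C ≤ C') : UpReg m α C' := by
  intro x r hr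
  refine (h x r hr).trans (ENNReal.ofReal_le_ofReal ?_)
  gcongr

lemma Dec.mono {m : Measure ℝ} {α C C' : ℝ} (h : Dec m α C) (hC : C ≤ C') : Dec m α C' := by
  intro ξ hξ
  refine (h ξ hξ).trans ?_
  gcongr

lemma scaled_piece {α β : ℝ} (hβ0 : 0 < β) (hβα : β < α) (hα1 : α < 1) {φ : ℝ → ℝ}
    (hφmono : ∀ s t : ℝ, 2 ≤ s → s ≤ t → φ s ≤ φ t)
    (hφtop : Tendsto φ atTop atTop) {t : ℕ} {ν : Measure ℝ} {c C : ℝ} (hP : Piece α β t ν c C)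
    {g : ℝ} (hg : 0 < g) :
    ∃ lam W, 0 < W ∧ SP α β φ g lam (ENNReal.ofReal W • ν.map (fun y : ℝ => lam * y + 0)) := by
  obtain ⟨T, hT⟩ := (eventually_atTop.1 (hφtop.eventually_ge_atTop (C / (g * c))))
  have hc := hP.c0
  have hC := hP.C0
  set M := max T 2 with hM
  have hM2 : 2 ≤ M := le_max_right _ _
  set lam : ℝ := 1 / (8 * M) with hlam
  have hl0 : 0 < lam := by positivity
  have hl1 : lam ≤ 1 := by
    rw [hlam, div_le_one (by positivity)]; linarith
  have hlM : 1 / (8 * lam) = M := by rw [hlam]; field_simp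
  set W := g * lam ^ α / C with hW
  have hW0 : 0 < W := by positivity
  have hWC : W * (C * lam ^ (-α)) = g := by
    rw [hW, Real.rpow_neg hl0.le]
    have := (Real.rpow_pos_of_pos hl0 α).ne'
    field_simp
  have hle : ∀ τ : ℝ, τ ≤ α → W * (C * lam ^ (-τ)) ≤ g := by
    intro τ hτ
    rw [← hWC]
    have : lam ^ (-τ) ≤ lam ^ (-α) := Real.rpow_le_rpow_of_exponent_ge hl0 hl1 (by linarith)
    gcongr
  refine ⟨lam, W, hW0, hl0, hl1, ?_, ?_, ?_, ?_, ?_⟩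
  · rw [Measure.smul_apply, (aff_emb hl0 0).map_apply]
    have : (fun y : ℝ => lam * y + 0) ⁻¹' (Set.Icc 0 lam)ᶜ ⊆ (Set.Icc 0 1)ᶜ := by
      intro y hy hy'
      apply hy
      constructor
      · have := hy'.1; positivity
      · have := hy'.2; nlinarith
    rw [measure_mono_null this hP.supp, smul_zero]
  · exact ((hP.up.map hl0 0).smul hW0.le).mono hWC.le
  · exact ((hP.dec.map hl0 0).smul hW0.le).mono (hle _ (by linarith))
  · rw [Measure.smul_apply, (aff_emb hl0 0).map_apply, Set.preimage_univ, smul_eq_mul]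
    refine (mul_le_mul_right hP.mass _).trans ?_
    rw [← ENNReal.ofReal_mul hW0.le]
    apply ENNReal.ofReal_le_ofReal
    have := hle 0 (by linarith)
    simpa using this
  · rw [Measure.ae_ennreal_smul_measure_iff (by simpa using hW0), (aff_emb hl0 0).ae_map_iff]
    filter_upwards [hP.lo] with x hx r hr hr1
    rw [Measure.smul_apply, aff_map_Icc hl0, smul_eq_mul]
    have e : (lam * x + 0 - 0) / lam = x := by field_simp; ring
    rw [e]
    have h1 : ENNReal.ofReal (c * (r / lam / 2) ^ α) ≤ ν (Set.Icc (x - r / lam) (x + r / lam)) := by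
      refine (hx (r / lam / 2) (by positivity) ?_).trans (measure_mono ?_)
      · rw [div_div, div_le_one (by positivity)]; linarith
      · have : 0 < r / lam := by positivity
        apply Set.Icc_subset_Icc <;> linarith
    refine le_trans ?_ (mul_le_mul_right h1 _)
    rw [← ENNReal.ofReal_mul hW0.le]
    apply ENNReal.ofReal_le_ofReal
    have h2 : C / (g * c) ≤ φ (1 / (4 * r)) := by
      have h3 : M ≤ 1 / (4 * r) := by
        rw [← hlM]
        apply one_div_le_one_div_of_le (by positivity); linarith
      exact (hT M (le_max_left _ _)).trans (hφmono _ _ hM2 h3)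
    have hpos : 0 < C / (g * c) := by positivity
    have h5 : 0 ≤ r ^ α / φ (1 / (4 * r)) := div_nonneg (by positivity) (hpos.trans_le h2).le
    have h4 : (1:ℝ) / 2 ≤ (1 / 2) ^ α := by
      have := Real.rpow_le_rpow_of_exponent_ge (x := (1/2:ℝ)) (by norm_num) (by norm_num) hα1.le
      simpa using this
    have e2 : r / lam / 2 = r * (1 / 2) * lam⁻¹ := by field_simp
    rw [e2, Real.mul_rpow (by positivity) (by positivity), Real.mul_rpow hr.le (by norm_num), Real.inv_rpow hl0.le, hW]
    have hla := (Real.rpow_pos_of_pos hl0 α)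
    calc 1 / 2 * (r ^ α / φ (1 / (4 * r))) ≤ (1 / 2) ^ α * (r ^ α / (C / (g * c))) := by gcongr
      _ = _ := by field_simp

end ChenSharp

namespace ChenSharp

lemma geom_ofReal : ∑' k : ℕ, ENNReal.ofReal ((1/2:ℝ)^k) = ENNReal.ofReal 2 := by
  rw [← ENNReal.ofReal_tsum_of_nonneg (fun k => by positivity) summable_geometric_two, tsum_geometric_two]

lemma assemble {α β : ℝ} (hβ0 : 0 < β) (hβα : β < α) (hα1 : α < 1) {φ : ℝ → ℝ}
    (hφpos : ∀ t : ℝ, 2 ≤ t → 0 < φ t)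
    (hφmono : ∀ s t : ℝ, 2 ≤ s → s ≤ t → φ s ≤ φ t)
    {σ : Measure ℝ} [IsProbabilityMeasure σ] {c C : ℝ} (hc : 0 < c) (hC : 0 < C)
    (hσs : σ (Set.Icc (-1) 1)ᶜ = 0) (hσu : UpReg σ α C) (hσl : LoReg σ α c) (hσd : Dec σ (β / 2) C)
    (hσ0 : ∀ r, 0 < r → r ≤ 1 → ENNReal.ofReal (c * r ^ α) ≤ σ (Set.Icc (0 - r) (0 + r)))
    {P : ℕ → Measure ℝ} {lam : ℕ → ℝ} (hP : ∀ k, SP α β φ ((1/2)^k) (lam k) (P k)) :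
    IsFiniteMeasure (σ + Measure.sum P) ∧ UpReg (σ + Measure.sum P) α (C + 2) ∧
    Dec (σ + Measure.sum P) (β / 2) (C + 2) ∧
    ∃ c₁, 0 < c₁ ∧ ∀ᵐ x ∂(σ + Measure.sum P), |x| ≤ 1 ∧ ∀ r, 0 < r → r ≤ 1 / 8 →
      ENNReal.ofReal (c₁ * (r ^ α / φ (1 / (4 * r)))) ≤ (σ + Measure.sum P) (Set.Icc (x - r) (x + r)) := by
  have hfs : IsFiniteMeasure (Measure.sum P) := by
    constructor
    rw [Measure.sum_apply _ MeasurableSet.univ]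
    refine lt_of_le_of_lt (ENNReal.tsum_le_tsum fun k => (hP k).mass) ?_
    rw [geom_ofReal]; exact ENNReal.ofReal_lt_top
  refine ⟨inferInstance, ?_, ?_, ?_⟩
  · intro x r hr
    rw [Measure.add_apply, Measure.sum_apply _ measurableSet_Icc, add_mul, ENNReal.ofReal_add (by positivity) (by positivity)]
    refine add_le_add (hσu x r hr) ((ENNReal.tsum_le_tsum fun k => (hP k).up x r hr).trans ?_)
    simp only [fun k : ℕ => ENNReal.ofReal_mul (p := (1/2:ℝ)^k) (q := r ^ α) (by positivity)]
    rw [ENNReal.tsum_mul_right, geom_ofReal, ENNReal.ofReal_mul (by norm_num)]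
  · intro ξ hξ
    rw [fhat_add, add_mul]
    refine (norm_add_le _ _).trans (add_le_add (hσd ξ hξ) ?_)
    unfold fhat
    rw [integral_sum_measure (integrable_ee _ ξ)]
    exact tsum_of_norm_bounded (hasSum_geometric_two.mul_right _) fun k => (hP k).dec ξ hξ
  · have h2 := hφpos 2 le_rfl
    have hφr : ∀ r : ℝ, 0 < r → r ≤ 1 / 8 → φ 2 ≤ φ (1 / (4 * r)) := by
      intro r hr hr1
      apply hφmono 2 _ le_rfl
      rw [le_div_iff₀ (by positivity)]; linarith
    have hhalf : (1:ℝ) / 2 ≤ (1 / 2) ^ α := by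
      have := Real.rpow_le_rpow_of_exponent_ge (x := (1/2:ℝ)) (by norm_num) (by norm_num) hα1.le
      simpa using this
    set c₁ := min (1 / 2) (c * φ 2 / 2) with hc₁
    have hc₁0 : 0 < c₁ := lt_min (by norm_num) (by positivity)
    have key : ∀ r : ℝ, 0 < r → r ≤ 1 / 8 → c₁ * (r ^ α / φ (1 / (4 * r))) ≤ c * (r / 2) ^ α := by
      intro r hr hr1
      have h3 := hφr r hr hr1
      have h4 : r / 2 = r * (1 / 2) := by ring
      rw [h4, Real.mul_rpow hr.le (by norm_num)]
      calc c₁ * (r ^ α / φ (1 / (4 * r))) ≤ (c * φ 2 / 2) * (r ^ α / φ 2) := by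
            have h5 : c₁ ≤ c * φ 2 / 2 := min_le_right _ _
            have h6 : 0 ≤ r ^ α / φ (1 / (4 * r)) := div_nonneg (by positivity) (h2.trans_le h3).le
            gcongr
        _ = c * (r ^ α * (1 / 2)) := by field_simp
        _ ≤ _ := by gcongr
    refine ⟨c₁, hc₁0, ?_⟩
    rw [ae_add_measure_iff]
    constructor
    · have hs : ∀ᵐ x ∂σ, x ∈ Set.Icc (-1:ℝ) 1 := hσs
      filter_upwards [hσl, hs] with x hx hxs
      refine ⟨abs_le.2 hxs, fun r hr hr1 => ?_⟩
      rw [Measure.add_apply]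
      refine le_trans ?_ le_self_add
      refine (ENNReal.ofReal_le_ofReal (key r hr hr1)).trans ((hx (r / 2) (by positivity) (by linarith)).trans (measure_mono ?_))
      apply Set.Icc_subset_Icc <;> linarith
    · rw [Measure.ae_sum_iff]
      intro k
      have hs : ∀ᵐ x ∂(P k), x ∈ Set.Icc (0:ℝ) (lam k) := (hP k).supp
      filter_upwards [(hP k).lo, hs] with x hx hxs
      have hl1 := (hP k).l1
      have hl0 := (hP k).l0
      refine ⟨abs_le.2 ⟨by linarith [hxs.1], by linarith [hxs.2]⟩, fun r hr hr1 => ?_⟩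
      rw [Measure.add_apply]
      rcases le_or_gt r (2 * lam k) with h | h
      · refine le_trans ?_ le_add_self
        rw [Measure.sum_apply _ measurableSet_Icc]
        refine le_trans ?_ (ENNReal.le_tsum k)
        refine le_trans (ENNReal.ofReal_le_ofReal ?_) (hx r hr h)
        refine mul_le_mul_of_nonneg_right (min_le_left _ _) (div_nonneg (by positivity) ?_)
        exact (h2.trans_le (hφr r hr hr1)).le
      · refine le_trans ?_ le_self_add
        refine (ENNReal.ofReal_le_ofReal (key r hr hr1)).trans ((hσ0 (r / 2) (by positivity) (by linarith)).trans (measure_mono ?_))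
        apply Set.Icc_subset_Icc <;> linarith [hxs.1, hxs.2]

lemma base_zero {α τ : ℝ} (hα0 : 0 < α) (hα1 : α < 1) (hτ0 : 0 < τ) (hτ : τ < α / 2) :
    ∃ (σ : Measure ℝ) (c C : ℝ), IsProbabilityMeasure σ ∧ 0 < c ∧ 0 < C ∧ σ (Set.Icc (-1) 1)ᶜ = 0 ∧
      UpReg σ α C ∧ LoReg σ α c ∧ Dec σ τ C ∧
      ∀ r, 0 < r → r ≤ 1 → ENNReal.ofReal (c * r ^ α) ≤ σ (Set.Icc (0 - r) (0 + r)) := by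
  obtain ⟨σ, c, C, hσ, hc, hC, hs, hu, hl, hd⟩ := base_measure hα0 hα1 hτ0 hτ
  have hs' : ∀ᵐ x ∂σ, x ∈ Set.Icc (0:ℝ) 1 := hs
  obtain ⟨x₀, hx₀, hx₁⟩ := (hl.and hs').exists
  have h1 := one_pos (α := ℝ)
  refine ⟨σ.map (fun y => 1 * y + (-x₀)), c, C, ?_, hc, hC, ?_, ?_, hl.map h1 le_rfl _, ?_, ?_⟩
  · exact Measure.isProbabilityMeasure_map (aff_emb h1 _).measurable.aemeasurable
  · rw [(aff_emb h1 _).map_apply]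
    refine measure_mono_null ?_ hs
    intro y hy hy'
    apply hy
    constructor <;> simp only [one_mul] <;> linarith [hx₁.1, hx₁.2, hy'.1, hy'.2]
  · simpa using hu.map h1 (-x₀)
  · simpa using hd.map h1 (-x₀)
  · intro r hr hr1
    rw [aff_map_Icc h1]
    simpa using hx₀ r hr hr1

end ChenSharp

namespace ChenSharp

lemma dd_ratio {α β q : ℝ} (hβ0 : 0 < β) (hβα : β < α) (hα1 : α < 1) (hq : 2 ≤ q)
    (hq2 : q < 2 + 4 * (1 - α) / β) :
    ∃ T : ℕ, ∀ t : ℕ, T ≤ t → 2 * (2 * t * dd α β t) ^ (1 / q) < dd α β t ^ (β / 4) := by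
  have hq0 : 0 < q := by linarith
  set γ := (β / 2 + (1 - α)) / q - β / 4 with hγ
  have hγ0 : 0 < γ := by
    have : (q - 2) * β < 4 * (1 - α) := by
      rw [← lt_div_iff₀ hβ0]; linarith
    rw [hγ, sub_pos, lt_div_iff₀ hq0]; linarith
  have hg0 : 0 < α - β / 2 := by linarith
  have h1 : Tendsto (fun t : ℕ => dd α β t) atTop (nhds 0) :=
    (tendsto_rpow_neg_atTop (by positivity : 0 < 1 / (α - β / 2))).comp tendsto_natCast_atTop_atTop
  have h2 : Tendsto (fun t : ℕ => dd α β t ^ γ) atTop (nhds 0) := by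
    have := h1.rpow_const (p := γ) (Or.inr hγ0.le)
    rwa [Real.zero_rpow hγ0.ne'] at this
  obtain ⟨T, hT⟩ := eventually_atTop.1 (h2.eventually_lt_const (by norm_num : (0:ℝ) < 1 / 4))
  refine ⟨max T 1, fun t ht => ?_⟩
  have ht1 : 1 ≤ t := (le_max_right _ _).trans ht
  have h3 := hT t ((le_max_left _ _).trans ht)
  have ht0 : (0:ℝ) < t := by exact_mod_cast ht1
  have hd0 : 0 < dd α β t := by unfold dd; positivity
  have e1 : t * dd α β t = dd α β t ^ (β / 2 + (1 - α)) := by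
    rw [Real.rpow_add hd0, ← dd_theta hβ0 hβα ht1, mul_assoc, ← Real.rpow_add hd0]
    simp
  have e2 : (t * dd α β t) ^ (1 / q) = dd α β t ^ (β / 4) * dd α β t ^ γ := by
    rw [e1, ← Real.rpow_mul hd0.le, ← Real.rpow_add hd0]
    congr 1; rw [hγ]; ring
  rw [mul_assoc, Real.mul_rpow (by norm_num) (by positivity), e2]
  have h4 : (2:ℝ) ^ (1 / q) ≤ 2 := by
    have := Real.rpow_le_rpow_of_exponent_le (x := (2:ℝ)) (by norm_num) (y := 1 / q) (z := 1) (by rw [div_le_one hq0]; linarith)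
    simpa using this
  have h5 : 0 < dd α β t ^ (β / 4) := by positivity
  have h6 : 0 < dd α β t ^ γ := by positivity
  calc 2 * ((2:ℝ) ^ (1 / q) * (dd α β t ^ (β / 4) * dd α β t ^ γ)) ≤ 2 * (2 * (dd α β t ^ (β / 4) * dd α β t ^ γ)) := by gcongr
    _ < 2 * (2 * (dd α β t ^ (β / 4) * (1 / 4))) := by gcongr
    _ = dd α β t ^ (β / 4) := by ring

lemma growth {a : ℕ → ℝ} {L : ℕ → ENNReal} {κ τ x lam q : ℝ} (hκ : 0 < κ) (hτ : 0 < τ) (hx : 0 < x)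
    (hl : 0 < lam) (hq : 0 < q) (hr : 2 * x ^ (1 / q) < τ)
    (ha : ∀ j, κ * (τ ^ 2) ^ j ≤ a j)
    (hL : ∀ j, ENNReal.ofReal (1 / 2 * (1 / 2) ^ j * a j) ≤ L j * ENNReal.ofReal ((lam * (3 * x ^ j)) ^ (1 / q)))
    (B : ℝ) : ∃ j, 1 ≤ j ∧ ENNReal.ofReal (B * Real.sqrt (a j)) < L j := by
  by_contra! hcon
  set y := x ^ (1 / q) with hy
  have hy0 : 0 < y := by positivity
  set K := max B 0 with hK
  have hK0 : 0 ≤ K := le_max_right _ _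
  set D := (lam * 3) ^ (1 / q) with hD
  have hD0 : 0 < D := by positivity
  have h1 : ∀ j, 1 ≤ j → Real.sqrt κ * (τ / (2 * y)) ^ j ≤ 2 * K * D := by
    intro j hj
    have haj : 0 < a j := lt_of_lt_of_le (by positivity) (ha j)
    have hs : 0 < Real.sqrt (a j) := Real.sqrt_pos.2 haj
    have e1 : (lam * (3 * x ^ j)) ^ (1 / q) = D * y ^ j := by
      rw [← mul_assoc, Real.mul_rpow (by positivity) (by positivity), hy, ← Real.rpow_natCast, ← Real.rpow_mul hx.le,
        ← Real.rpow_natCast, ← Real.rpow_mul hx.le, mul_comm (j:ℝ)]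
    have h2 : ENNReal.ofReal (1 / 2 * (1 / 2) ^ j * a j) ≤ ENNReal.ofReal (K * Real.sqrt (a j) * (D * y ^ j)) := by
      refine (hL j).trans ?_
      rw [e1, ENNReal.ofReal_mul (p := K * Real.sqrt (a j)) (by positivity)]
      gcongr
      refine (hcon j hj).trans (ENNReal.ofReal_le_ofReal ?_)
      gcongr
      exact le_max_left _ _
    rw [ENNReal.ofReal_le_ofReal_iff (by positivity)] at h2
    have h3 : 1 / 2 * (1 / 2) ^ j * Real.sqrt (a j) ≤ K * (D * y ^ j) := by
      have e : a j = Real.sqrt (a j) * Real.sqrt (a j) := (Real.mul_self_sqrt haj.le).symm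
      refine le_of_mul_le_mul_right ?_ hs
      calc _ = 1 / 2 * (1 / 2) ^ j * a j := by rw [mul_assoc, ← e]
        _ ≤ _ := h2
        _ = _ := by ring
    have h4 : Real.sqrt κ * τ ^ j ≤ Real.sqrt (a j) := by
      apply Real.le_sqrt_of_sq_le
      rw [mul_pow, Real.sq_sqrt hκ.le, ← pow_mul, mul_comm j 2, pow_mul]
      exact ha j
    have h5 : 1 / 2 * (1 / 2) ^ j * (Real.sqrt κ * τ ^ j) ≤ K * (D * y ^ j) := le_trans (by gcongr) h3
    rw [div_pow, mul_pow]
    rw [← mul_div_assoc, div_le_iff₀ (by positivity)]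
    have e3 : (1 / 2 : ℝ) ^ j * 2 ^ j = 1 := by rw [← mul_pow]; norm_num
    calc Real.sqrt κ * τ ^ j = 2 * 2 ^ j * (1 / 2 * (1 / 2) ^ j * (Real.sqrt κ * τ ^ j)) := by
          linear_combination (-(Real.sqrt κ * τ ^ j)) * e3
      _ ≤ 2 * 2 ^ j * (K * (D * y ^ j)) := by gcongr
      _ = _ := by ring
  have hρ : 1 < τ / (2 * y) := by rw [one_lt_div (by positivity)]; exact hr
  have hsk : 0 < Real.sqrt κ := Real.sqrt_pos.2 hκ
  have ht := (tendsto_pow_atTop_atTop_of_one_lt hρ).const_mul_atTop hsk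
  obtain ⟨j, hj1, hj2⟩ := ((ht.eventually_gt_atTop (2 * K * D)).and (eventually_ge_atTop 1)).exists
  exact absurd (h1 j hj2) (not_le.2 hj1)

end ChenSharp

namespace ChenSharp

def FF (lam d s : ℝ) (t j : ℕ) : Set ℝ := {x | x / lam ∈ AA d s t j}

lemma FF_eq {lam d s : ℝ} (hl : 0 < lam) (t j : ℕ) :
    FF lam d s t j = ⋃ p ∈ (PP d s t j).image (fun p : ℝ × ℝ => (lam * p.1, lam * p.2)), Set.Ico p.1 p.2 := by
  ext x
  simp only [FF, AA, Set.mem_ofPred_eq, Set.mem_iUnion, Finset.mem_image, Set.mem_Ico]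
  constructor
  · rintro ⟨p, hp, h1, h2⟩
    refine ⟨_, ⟨p, hp, rfl⟩, ?_, ?_⟩
    · rw [le_div_iff₀ hl] at h1; simp only; linarith
    · rw [div_lt_iff₀ hl] at h2; simp only; linarith
  · rintro ⟨_, ⟨p, hp, rfl⟩, h1, h2⟩
    simp only at h1 h2
    refine ⟨p, hp, ?_, ?_⟩
    · rw [le_div_iff₀ hl]; linarith
    · rw [div_lt_iff₀ hl]; linarith

lemma FF_meas {lam d s : ℝ} (hl : 0 < lam) (t j : ℕ) : MeasurableSet (FF lam d s t j) := by
  rw [FF_eq hl]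
  exact Finset.measurableSet_biUnion _ fun p _ => measurableSet_Ico

lemma FF_preimage {lam d s : ℝ} (hl : 0 < lam) (t j : ℕ) :
    (fun y : ℝ => lam * y + 0) ⁻¹' (FF lam d s t j) = AA d s t j := by
  ext y
  simp only [FF, Set.mem_preimage, Set.mem_ofPred_eq, add_zero]
  rw [mul_div_cancel_left₀ _ hl.ne']

end ChenSharp

open ChenSharp

theorem sharpness_L2_restriction_strict (α β C₀ : ℝ) (hβ0 : 0 < β) (hβα : β < α) (hα1 : α < 1)
    (φ : ℝ → ℝ) (hφpos : ∀ t : ℝ, 2 ≤ t → 0 < φ t)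
    (hφmono : ∀ s t : ℝ, 2 ≤ s → s ≤ t → φ s ≤ φ t)
    (hφtop : Tendsto φ atTop atTop)
    (hφdbl : ∀ t : ℝ, 2 ≤ t → φ (2 * t) ≤ φ t + C₀) :
    ∃ (E : Set ℝ) (μ : Measure ℝ) (F : ℕ → Set ℝ) (c C : ℝ),
      IsCompact E ∧ IsProbabilityMeasure μ ∧ μ E = 1 ∧ 0 < c ∧ c ≤ C ∧
      (∀ l : ℕ, 1 ≤ l →
        (∃ S : Finset (ℝ × ℝ), F l = ⋃ p ∈ S, Set.Ico p.1 p.2) ∧ 0 < μ (F l)) ∧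
      (∀ ξ : ℝ, ξ ≠ 0 →
        ‖∫ x : ℝ, Complex.exp (-(2 * (Real.pi : ℂ) * Complex.I * (ξ : ℂ) * (x : ℂ))) ∂μ‖
          ≤ C * |ξ| ^ (-(β / 2))) ∧
      (∀ x ∈ E, ∀ r : ℝ, 0 < r → r < 1 / 4 →
        c * (2 * r) ^ α / φ (1 / (2 * r)) ≤ (μ (Set.Icc (x - r) (x + r))).toReal ∧
        (μ (Set.Icc (x - r) (x + r))).toReal ≤ C * (2 * r) ^ α) ∧
      (∀ q : ℝ, 2 ≤ q → q < 2 + 4 * (1 - α) / β →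
        ∀ B : ℝ, ∃ l : ℕ, 1 ≤ l ∧
          ENNReal.ofReal (B * Real.sqrt ((μ (F l)).toReal)) <
            eLpNorm (fun ξ : ℝ => ∫ x in F l,
                Complex.exp (-(2 * (Real.pi : ℂ) * Complex.I * (ξ : ℂ) * (x : ℂ))) ∂μ)
              (ENNReal.ofReal q) volume) := by
  have hα0 : 0 < α := hβ0.trans hβα
  obtain ⟨σ, c₀, C₁, hσ, hc₀, hC₁, hσs, hσu, hσl, hσd, hσ0⟩ :=
    base_zero (τ := β / 2) hα0 hα1 (by positivity) (by linarith)
  obtain ⟨t₀, ht₀, hpc⟩ := exists_piece hβ0 hβα hα1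
  have hpc' : ∀ k : ℕ, ∃ ν c C, Piece α β (k + t₀) ν c C := fun k => (hpc (k + t₀) (by omega)).2
  choose ν pc pC hν using hpc'
  have hsc : ∀ k : ℕ, ∃ lam W, 0 < W ∧ SP α β φ ((1/2)^k) lam (ENNReal.ofReal W • (ν k).map (fun y : ℝ => lam * y + 0)) :=
    fun k => scaled_piece hβ0 hβα hα1 hφmono hφtop (hν k) (by positivity)
  choose lam W hW hSP using hsc
  obtain ⟨hfin, hup, hdec, c₁, hc₁, hgood⟩ :=
    assemble hβ0 hβα hα1 hφpos hφmono hc₀ hC₁ hσs hσu hσl hσd hσ0 hSP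
  set P : ℕ → Measure ℝ := fun k => ENNReal.ofReal (W k) • (ν k).map (fun y : ℝ => lam k * y + 0) with hPdef
  set m := σ + Measure.sum P with hm
  set Z := (m Set.univ).toReal with hZ
  have hm1 : 1 ≤ m Set.univ := by
    rw [hm, Measure.add_apply, measure_univ]; exact le_self_add
  have hZ1 : 1 ≤ Z := by
    have := ENNReal.toReal_mono (measure_ne_top m _) hm1
    simpa using this
  have hZ0 : 0 < Z := by linarith
  have hZi : Z⁻¹ ≤ 1 := inv_le_one_of_one_le₀ hZ1
  set μ := ENNReal.ofReal Z⁻¹ • m with hμ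
  have hμp : IsProbabilityMeasure μ := by
    constructor
    rw [hμ, Measure.smul_apply, smul_eq_mul, ← ENNReal.ofReal_toReal (measure_ne_top m Set.univ), ← hZ,
      ← ENNReal.ofReal_mul (by positivity), inv_mul_cancel₀ hZ0.ne', ENNReal.ofReal_one]
  have hμu : UpReg μ α (C₁ + 2) := (hup.smul (by positivity)).mono (by nlinarith)
  have hμd : Dec μ (β / 2) (C₁ + 2) := (hdec.smul (by positivity)).mono (by nlinarith)
  set G : Set ℝ := {x | |x| ≤ 1 ∧ ∀ r, 0 < r → r ≤ 1 / 8 →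
      ENNReal.ofReal (c₁ * (r ^ α / φ (1 / (4 * r)))) ≤ m (Set.Icc (x - r) (x + r))} with hG
  set c := Z⁻¹ * c₁ / 4 with hc
  have hc0 : 0 < c := by positivity
  have hmF : ∀ k j, Z⁻¹ * W k * ((dd α β (k + t₀) ^ (β / 4)) ^ 2) ^ j ≤
      (μ (FF (lam k) (dd α β (k + t₀)) (sg (k + t₀)) (k + t₀) j)).toReal := by
    intro k j
    have hd0 : 0 < dd α β (k + t₀) := (hpc (k + t₀) (by omega)).1.1
    have e : (dd α β (k + t₀) ^ (β / 4)) ^ 2 = dd α β (k + t₀) ^ (β / 2) := by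
      rw [← Real.rpow_natCast, ← Real.rpow_mul hd0.le]; congr 1; push_cast; ring
    rw [e, ← ENNReal.ofReal_le_iff_le_toReal (measure_ne_top _ _), hμ, Measure.smul_apply, smul_eq_mul, mul_assoc,
      ENNReal.ofReal_mul (by positivity)]
    refine mul_le_mul_right ?_ _
    rw [hm, Measure.add_apply, Measure.sum_apply _ (FF_meas (hSP k).l0 _ _)]
    refine le_trans (le_trans ?_ (ENNReal.le_tsum k)) le_add_self
    rw [hPdef]
    simp only
    rw [Measure.smul_apply, (aff_emb (hSP k).l0 0).map_apply, FF_preimage (hSP k).l0, smul_eq_mul,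
      ENNReal.ofReal_mul (hW k).le]
    exact mul_le_mul_right ((hν k).AA j) _
  have hpos : ∀ k j, 0 < Z⁻¹ * W k * ((dd α β (k + t₀) ^ (β / 4)) ^ 2) ^ j := by
    intro k j
    have hd0 : 0 < dd α β (k + t₀) := (hpc (k + t₀) (by omega)).1.1
    have := hW k
    positivity
  refine ⟨closure G, μ, fun l => FF (lam (Nat.unpair (l - 1)).1) (dd α β ((Nat.unpair (l - 1)).1 + t₀))
    (sg ((Nat.unpair (l - 1)).1 + t₀)) ((Nat.unpair (l - 1)).1 + t₀) (Nat.unpair (l - 1)).2, c, max c (C₁ + 2),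
    ?_, hμp, ?_, hc0, le_max_left _ _, ?_, ?_, ?_, ?_⟩
  · have hb : Bornology.IsBounded G := by
      refine (Metric.isBounded_closedBall (x := (0:ℝ)) (r := 1)).subset fun x hx => ?_
      rw [mem_closedBall_zero_iff]; exact hx.1
    exact hb.isCompact_closure
  · have h1 : ∀ᵐ x ∂μ, x ∈ closure G := by
      have : ∀ᵐ x ∂m, x ∈ closure G := hgood.mono fun x hx => subset_closure hx
      exact Measure.ae_smul_measure this _
    exact (prob_compl_eq_zero_iff isClosed_closure.measurableSet).1 h1
  · intro l _
    refine ⟨⟨_, FF_eq (hSP _).l0 _ _⟩, ?_⟩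
    have := (hpos _ _).trans_le (hmF (Nat.unpair (l - 1)).1 (Nat.unpair (l - 1)).2)
    exact (ENNReal.toReal_pos_iff.1 this).1
  · exact hμd.mono (le_max_right _ _)
  · intro x hx r hr hr4
    constructor
    · obtain ⟨x', hx', hd⟩ := Metric.mem_closure_iff.1 hx (r / 2) (by positivity)
      rw [Real.dist_eq, abs_lt] at hd
      have h1 := hx'.2 (r / 2) (by positivity) (by linarith)
      have h2 : m (Set.Icc (x' - r / 2) (x' + r / 2)) ≤ m (Set.Icc (x - r) (x + r)) := by
        apply measure_mono
        apply Set.Icc_subset_Icc <;> linarith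
      have e1 : 4 * (r / 2) = 2 * r := by ring
      rw [e1] at h1
      have hφ0 : 0 < φ (1 / (2 * r)) := by
        apply hφpos
        rw [le_div_iff₀ (by positivity)]; linarith
      rw [← ENNReal.ofReal_le_iff_le_toReal (measure_ne_top _ _), hμ, Measure.smul_apply, smul_eq_mul]
      refine le_trans ?_ (mul_le_mul_right (h1.trans h2) _)
      rw [← ENNReal.ofReal_mul (by positivity)]
      apply ENNReal.ofReal_le_ofReal
      have h3 : (2 * r) ^ α / 4 ≤ (r / 2) ^ α := by
        have e2 : r / 2 = 2 * r * (1 / 4) := by ring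
        rw [e2, Real.mul_rpow (x := 2 * r) (y := 1 / 4) (by positivity) (by norm_num)]
        have h4 : (1:ℝ) / 4 ≤ (1 / 4) ^ α := by
          have := Real.rpow_le_rpow_of_exponent_ge (x := (1/4:ℝ)) (by norm_num) (by norm_num) hα1.le
          simpa using this
        have : 0 ≤ (2 * r) ^ α := by positivity
        nlinarith
      calc c * (2 * r) ^ α / φ (1 / (2 * r)) = Z⁻¹ * (c₁ * ((2 * r) ^ α / 4 / φ (1 / (2 * r)))) := by
            rw [hc]; ring
        _ ≤ _ := by gcongr
    · refine ENNReal.toReal_le_of_le_ofReal (by positivity) ((hμu x r hr).trans (ENNReal.ofReal_le_ofReal ?_))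
      have : r ≤ 2 * r := by linarith
      gcongr
      exact le_max_right _ _
  · intro q hq hq2 B
    obtain ⟨T, hT⟩ := dd_ratio hβ0 hβα hα1 hq hq2
    have hr := hT (T + t₀) (by omega)
    obtain ⟨⟨hd0, hd1, hds⟩, -⟩ := hpc (T + t₀) (by omega)
    have ht1 : 1 ≤ T + t₀ := by omega
    have ht0 : (0:ℝ) < ((T + t₀ : ℕ) : ℝ) := by exact_mod_cast ht1
    have hs0 : 0 < sg (T + t₀) := by unfold sg; positivity
    have hts : ((T + t₀ : ℕ) : ℝ) * sg (T + t₀) ≤ 1 / 8 := by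
      unfold sg; apply le_of_eq; field_simp
    obtain ⟨j, hj, hj2⟩ := growth (a := fun j => (μ (FF (lam T) (dd α β (T + t₀)) (sg (T + t₀)) (T + t₀) j)).toReal)
      (L := fun j => eLpNorm (fun ξ : ℝ => ∫ x in FF (lam T) (dd α β (T + t₀)) (sg (T + t₀)) (T + t₀) j,
        ee ξ x ∂μ) (ENNReal.ofReal q) volume)
      (κ := Z⁻¹ * W T) (τ := dd α β (T + t₀) ^ (β / 4)) (x := 2 * ((T + t₀ : ℕ) : ℝ) * dd α β (T + t₀)) (lam := lam T) (q := q)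
      (mul_pos (by positivity) (hW T)) (by positivity) (by positivity) (hSP T).l0 (by linarith) hr
      (hmF T) (by
        intro j
        obtain ⟨w, h, Tt, hh⟩ := exists_test hd0 hs0 ht1 hts hds j
        exact (Tt.scale (hSP T).l0 (hSP T).l1).bound μ (FF_meas (hSP T).l0 _ _)
          (fun x hx => hh _ hx) hq) B
    refine ⟨Nat.pair T j + 1, by omega, ?_⟩
    simp only [Nat.add_sub_cancel, Nat.unpair_pair]
    exact hj2
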